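/- arXiv:1301.4185 — 8 statements merged into one kernel-verified Lean document; each statement's English description precedes it below -/
import Mathlib

section
/- The function g : ℝ₊ → ℝ₊ defined by g(c) = min_{x∈[0,1]} max( c·x − h₂(x) , (1−x)²·((1−x) ∨ (4x−2)⁺)² / (8 ln 2) ) is monotonically increasing on [0,∞), and g(c) = 0 if and only if c = 0. -/
/-- Binary entropy function (in bits), with the convention `0 * log₂ 0 = 0`. -/
noncomputable def H2 (x : ℝ) : ℝ := -(x * Real.logb 2 x) - (1 - x) * Real.logb 2 (1 - x)

/-- The function `g(c) = min_{x ∈ [0,1]} max( c·x − h₂(x) ,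
(1−x)²·((1−x) ∨ (4x−2)⁺)² / (8 ln 2) )`. -/
noncomputable def gIID (c : ℝ) : ℝ :=
  sInf ((fun x : ℝ => max (c * x - H2 x)
    ((1 - x) ^ 2 * (max (1 - x) (max (4 * x - 2) 0)) ^ 2 / (8 * Real.log 2)))
    '' Set.Icc (0 : ℝ) 1)

theorem H2_cont : Continuous H2 := by
  have h : H2 = fun x => -(x * Real.log x) / Real.log 2
      - ((1 - x) * Real.log (1 - x)) / Real.log 2 := by
    funext x
    simp only [H2, Real.logb]
    ring
  rw [h]
  have h1 := Real.continuous_mul_log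
  have h2 : Continuous fun x : ℝ => (1 - x) * Real.log (1 - x) :=
    h1.comp (continuous_const.sub continuous_id)
  exact (h1.neg.div_const _).sub (h2.div_const _)

theorem snd_nonneg (x : ℝ) :
    0 ≤ (1 - x) ^ 2 * (max (1 - x) (max (4 * x - 2) 0)) ^ 2 / (8 * Real.log 2) := by
  have := Real.log_pos (by norm_num : (1 : ℝ) < 2)
  positivity

theorem gIID_attained (c : ℝ) : ∃ x ∈ Set.Icc (0 : ℝ) 1,
    gIID c = max (c * x - H2 x)
      ((1 - x) ^ 2 * (max (1 - x) (max (4 * x - 2) 0)) ^ 2 / (8 * Real.log 2)) := by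
  have hc := H2_cont
  refine isCompact_Icc.exists_sInf_image_eq ⟨0, by simp⟩ (Continuous.continuousOn ?_)
  exact ((continuous_const.mul continuous_id).sub hc).max (by fun_prop)

theorem gIID_le (c x : ℝ) (hx : x ∈ Set.Icc (0 : ℝ) 1) :
    gIID c ≤ max (c * x - H2 x)
      ((1 - x) ^ 2 * (max (1 - x) (max (4 * x - 2) 0)) ^ 2 / (8 * Real.log 2)) := by
  refine csInf_le ⟨0, ?_⟩ ⟨x, hx, rfl⟩
  rintro _ ⟨y, _, rfl⟩
  exact le_max_of_le_right (snd_nonneg y)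

/-- `g` is monotonically increasing on `[0,∞)`, and `g(c) = 0` iff `c = 0`. -/
theorem stmt1 :
    MonotoneOn gIID (Set.Ici 0) ∧ (∀ c : ℝ, 0 ≤ c → (gIID c = 0 ↔ c = 0)) := by
  constructor
  · intro a _ b _ hab
    obtain ⟨x, hx, h⟩ := gIID_attained b
    rw [h]
    refine (gIID_le a x hx).trans (max_le_max ?_ le_rfl)
    have := mul_le_mul_of_nonneg_right hab hx.1
    linarith
  · intro c hc
    obtain ⟨x, hx, h⟩ := gIID_attained c
    constructor
    · intro h0
      rw [h] at h0
      have h1 := (le_max_left _ _).trans h0.le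
      have h2 := (le_max_right _ _).trans h0.le
      have h3 := le_antisymm h2 (snd_nonneg x)
      have hl := Real.log_pos (by norm_num : (1 : ℝ) < 2)
      have hx1 : x = 1 := by
        by_contra hne
        have hlt : 0 < 1 - x := by
          have := lt_of_le_of_ne hx.2 hne
          linarith
        have hm : 0 < max (1 - x) (max (4 * x - 2) 0) := lt_max_of_lt_left hlt
        have : 0 < (1 - x) ^ 2 * (max (1 - x) (max (4 * x - 2) 0)) ^ 2 / (8 * Real.log 2) := by
          positivity
        linarith
      subst hx1
      simp [H2] at h1
      linarith
    · rintro rfl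
      refine le_antisymm ?_ (h ▸ le_max_of_le_right (snd_nonneg x))
      have := gIID_le 0 1 (by simp)
      simpa [H2] using this
end

section
/- The function g : ℝ₊ → ℝ₊ defined by g(c) = min_{x∈[0,1]} max( c·x − h₂(x) , (1−x)²·((1−x) ∨ (4x−2)⁺)² / (8 ln 2) ) satisfies g(c) ≤ 1/(8 ln 2) for all c ≥ 0 and lim_{c→∞} g(c) = 1/(8 ln 2) = (log₂ e)/8. -/
lemma H2_le_one (x : ℝ) : H2 x ≤ 1 := by
  have h2 : 0 < Real.log 2 := Real.log_pos (by norm_num)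
  have h := Real.binEntropy_le_log_two (p := x)
  have e : H2 x = Real.binEntropy x / Real.log 2 := by
    simp only [H2, Real.logb, Real.binEntropy, Real.log_inv]
    ring
  rw [e, div_le_one h2]
  exact h

lemma gIID_le_s2 (c : ℝ) : gIID c ≤ 1 / (8 * Real.log 2) := by
  have h2 : 0 < Real.log 2 := Real.log_pos (by norm_num)
  apply csInf_le
  · refine ⟨0, ?_⟩
    rintro _ ⟨x, _, rfl⟩
    exact le_max_of_le_right (by positivity)
  · refine ⟨0, by simp, ?_⟩
    have : (0 : ℝ) ≤ 1 / (8 * Real.log 2) := by positivity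
    norm_num [H2]
    positivity

lemma le_gIID (c : ℝ) (hc : 1 + 1 / (8 * Real.log 2) ≤ c) :
    1 / (8 * Real.log 2) * (1 - (1 + 1 / (8 * Real.log 2)) / c) ^ 4 ≤ gIID c := by
  have h2 : 0 < Real.log 2 := Real.log_pos (by norm_num)
  have hK : 0 < 1 / (8 * Real.log 2) := by positivity
  apply le_csInf (Set.Nonempty.image _ ⟨0, by simp⟩)
  rintro _ ⟨x, ⟨hx0, hx1⟩, rfl⟩
  have hdiv : (1 - x) ^ 2 * (max (1 - x) (max (4 * x - 2) 0)) ^ 2 / (8 * Real.log 2)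
      = 1 / (8 * Real.log 2) * ((1 - x) ^ 2 * (max (1 - x) (max (4 * x - 2) 0)) ^ 2) := by ring
  simp only [hdiv]
  generalize 1 / (8 * Real.log 2) = K at *
  have hc0 : 0 < c := by linarith
  have hd1 : (1 + K) / c ≤ 1 := (div_le_one hc0).2 hc
  have hd0 : 0 ≤ (1 + K) / c := by positivity
  rcases le_total x ((1 + K) / c) with h | h
  · apply le_max_of_le_right
    apply mul_le_mul_of_nonneg_left _ hK.le
    calc (1 - (1 + K) / c) ^ 4 ≤ (1 - x) ^ 4 :=
          pow_le_pow_left₀ (by linarith) (by linarith) 4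
      _ = (1 - x) ^ 2 * (1 - x) ^ 2 := by ring
      _ ≤ _ := by
          apply mul_le_mul_of_nonneg_left _ (by positivity)
          exact pow_le_pow_left₀ (by linarith) (le_max_left _ _) 2
  · apply le_max_of_le_left
    have h1 : 1 + K ≤ c * x := by
      rw [div_le_iff₀ hc0] at h
      linarith
    have h3 := H2_le_one x
    have h4 : (1 - (1 + K) / c) ^ 4 ≤ 1 := pow_le_one₀ (by linarith) (by linarith)
    have h5 := mul_le_mul_of_nonneg_left h4 hK.le
    linarith

theorem stmt2 :
    (∀ c : ℝ, 0 ≤ c → gIID c ≤ 1 / (8 * Real.log 2)) ∧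
    Filter.Tendsto gIID Filter.atTop (nhds (1 / (8 * Real.log 2))) ∧
    1 / (8 * Real.log 2) = Real.logb 2 (Real.exp 1) / 8 := by
  refine ⟨fun c _ => gIID_le_s2 c, ?_, ?_⟩
  · have hl : Filter.Tendsto (fun c : ℝ => 1 / (8 * Real.log 2) *
        (1 - (1 + 1 / (8 * Real.log 2)) / c) ^ 4) Filter.atTop
        (nhds (1 / (8 * Real.log 2) * (1 - 0) ^ 4)) :=
      ((tendsto_const_nhds.sub
        (tendsto_const_nhds.div_atTop Filter.tendsto_id)).pow 4).const_mul _
    rw [sub_zero, one_pow, mul_one] at hl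
    refine tendsto_of_tendsto_of_tendsto_of_le_of_le' hl tendsto_const_nhds ?_
      (Filter.Eventually.of_forall gIID_le_s2)
    filter_upwards [Filter.eventually_ge_atTop (1 + 1 / (8 * Real.log 2))] with c hc
    exact le_gIID c hc
  · rw [Real.logb, Real.log_exp]
    ring
end

section
/- Let p₁ and p₂ be probability distributions on ℤ with finite entropies H(p₁) = c and H(p₂) = d. Then H(p₁⋆p₂) − (c+d)/2 ≥ g(c,d), where g(c,d) = (1/2) · min_{(x,y)∈[0,1]²} max( d·x − h₂(x) + c·y − h₂(y) , l(x,y) ), with l(x,y) = min_{(a,b)∈T(x,y)} ((1−x)²a² + (1−y)²b²)/(8 ln 2) and T(x,y) = {(a,b) ∈ ℝ₊² : a ≥ (4y−2)⁺, b ≥ (4x−2)⁺, a+b ≥ 2−x−y}. -/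
/-- `p` is a probability distribution on `ℤ`. -/
def IsPMF (p : ℤ → ℝ) : Prop := (∀ k, 0 ≤ p k) ∧ HasSum p 1

/-- Convolution of two distributions on `ℤ`. -/
noncomputable def conv (p q : ℤ → ℝ) : ℤ → ℝ := fun k => ∑' j, p j * q (k - j)

/-- Shannon entropy (in bits) of a distribution on `ℤ`. -/
noncomputable def entH (p : ℤ → ℝ) : ℝ := ∑' k, -(p k * Real.logb 2 (p k))

/-- The constraint set `T(x,y) = {(a,b) ∈ ℝ₊² : a ≥ (4y−2)⁺, b ≥ (4x−2)⁺, a+b ≥ 2−x−y}`. -/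
def Tset (x y : ℝ) : Set (ℝ × ℝ) :=
  {ab | 0 ≤ ab.1 ∧ 0 ≤ ab.2 ∧ max (4 * y - 2) 0 ≤ ab.1 ∧ max (4 * x - 2) 0 ≤ ab.2 ∧
    2 - x - y ≤ ab.1 + ab.2}

/-- `l(x,y) = min_{(a,b) ∈ T(x,y)} ((1−x)²a² + (1−y)²b²)/(8 ln 2)`. -/
noncomputable def lfun (x y : ℝ) : ℝ :=
  sInf ((fun ab : ℝ × ℝ => ((1 - x) ^ 2 * ab.1 ^ 2 + (1 - y) ^ 2 * ab.2 ^ 2) / (8 * Real.log 2))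
    '' Tset x y)

/-- `g(c,d) = (1/2)·min_{(x,y)∈[0,1]²} max( d·x − h₂(x) + c·y − h₂(y) , l(x,y) )`. -/
noncomputable def gNIID (c d : ℝ) : ℝ :=
  (1 / 2) * sInf ((fun xy : ℝ × ℝ =>
      max (d * xy.1 - H2 xy.1 + c * xy.2 - H2 xy.2) (lfun xy.1 xy.2))
    '' (Set.Icc (0 : ℝ) 1 ×ˢ Set.Icc (0 : ℝ) 1))

open Real

lemma phi_hasDeriv (t : ℝ) (ht : 0 < t) :
    HasDerivAt (fun t : ℝ => log t - (5 * t ^ 2 - 4 * t - 1) / (2 * t ^ 2 + 4 * t))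
      (4 * (t - 1) ^ 3 / (2 * t ^ 2 + 4 * t) ^ 2) t := by
  have hD : (2 * t ^ 2 + 4 * t) ≠ 0 := by positivity
  have h1 : HasDerivAt (fun t : ℝ => 5 * t ^ 2 - 4 * t - 1) (10 * t - 4) t := by
    have := (((hasDerivAt_id t).pow 2).const_mul 5).sub ((hasDerivAt_id t).const_mul 4) |>.sub_const 1
    refine this.congr_deriv ?_
    simp; ring
  have h2 : HasDerivAt (fun t : ℝ => 2 * t ^ 2 + 4 * t) (4 * t + 4) t := by
    have := (((hasDerivAt_id t).pow 2).const_mul 2).add ((hasDerivAt_id t).const_mul 4)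
    refine this.congr_deriv ?_
    simp; ring
  refine ((hasDerivAt_log ht.ne').sub (h1.div h2 hD)).congr_deriv ?_
  have : t ≠ 0 := ht.ne'
  field_simp
  ring

lemma log_ge_phi (t : ℝ) (ht : 0 < t) :
    (5 * t ^ 2 - 4 * t - 1) / (2 * t ^ 2 + 4 * t) ≤ log t := by
  rcases le_total 1 t with h | h
  · have hm : MonotoneOn (fun t : ℝ => log t - (5 * t ^ 2 - 4 * t - 1) / (2 * t ^ 2 + 4 * t))
        (Set.Ici 1) := by
      apply monotoneOn_of_deriv_nonneg (convex_Ici 1)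
      · intro s hs
        exact (phi_hasDeriv s (lt_of_lt_of_le one_pos hs)).continuousAt.continuousWithinAt
      · intro s hs
        rw [interior_Ici] at hs
        exact (phi_hasDeriv s (lt_trans one_pos hs)).differentiableAt.differentiableWithinAt
      · intro s hs
        rw [interior_Ici] at hs
        have hs' : (1:ℝ) < s := hs
        rw [(phi_hasDeriv s (lt_trans one_pos hs)).deriv]
        have : 0 < s - 1 := by linarith
        positivity
    have := hm (Set.mem_Ici.2 le_rfl) (Set.mem_Ici.2 h) h
    norm_num at this
    linarith
  · have hm : AntitoneOn (fun t : ℝ => log t - (5 * t ^ 2 - 4 * t - 1) / (2 * t ^ 2 + 4 * t))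
        (Set.Ioc 0 1) := by
      apply antitoneOn_of_deriv_nonpos (convex_Ioc 0 1)
      · intro s hs
        exact (phi_hasDeriv s hs.1).continuousAt.continuousWithinAt
      · intro s hs
        rw [interior_Ioc] at hs
        exact (phi_hasDeriv s hs.1).differentiableAt.differentiableWithinAt
      · intro s hs
        rw [interior_Ioc] at hs
        rw [(phi_hasDeriv s hs.1).deriv]
        have : 0 < 1 - s := by linarith [hs.2]
        have h3 : 0 < (1 - s) ^ 3 := by positivity
        apply div_nonpos_of_nonpos_of_nonneg _ (by positivity)
        nlinarith
    have := hm (Set.mem_Ioc.2 ⟨ht, h⟩) (Set.mem_Ioc.2 ⟨one_pos, le_rfl⟩) h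
    norm_num at this
    linarith

/-- pointwise Pinsker -/
lemma pinsker_pt (u r δ : ℝ) (hu : 0 ≤ u) (hr : 0 ≤ r) (h0 : r = 0 → u = 0) :
    negMulLog u + δ * |u - r| - δ ^ 2 / 6 * (u + 2 * r) ≤ -(u * log r) - u + r := by
  rcases hr.eq_or_lt with hr | hr
  · have := h0 hr.symm
    subst this; subst hr; simp
  rcases hu.eq_or_lt with hu | hu
  · subst hu
    simp [abs_of_pos hr]
    nlinarith [mul_nonneg hr.le (sq_nonneg (δ - 3/2))]
  have key := log_ge_phi (u / r) (by positivity)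
  have e : (5 * (u/r) ^ 2 - 4 * (u/r) - 1) / (2 * (u/r) ^ 2 + 4 * (u/r))
      = (5 * u ^ 2 - 4 * u * r - r ^ 2) / (2 * u * (u + 2 * r)) := by
    field_simp; try ring
  rw [e, log_div hu.ne' hr.ne'] at key
  have k2 : (5 * u ^ 2 - 4 * u * r - r ^ 2) / (2 * (u + 2 * r)) ≤ u * (log u - log r) := by
    have := mul_le_mul_of_nonneg_left key hu.le
    refine le_trans (le_of_eq ?_) this
    field_simp; try ring
  have k3 : (5 * u ^ 2 - 4 * u * r - r ^ 2) / (2 * (u + 2 * r)) =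
      u - r + 3 / 2 * (|u - r| ^ 2 / (u + 2 * r)) := by
    rw [sq_abs]; field_simp; ring
  have k4 : 2 * (δ/3) * |u - r| - (δ/3)^2 * (u + 2 * r) ≤ |u - r| ^ 2 / (u + 2 * r) := by
    rw [le_div_iff₀ (by positivity)]
    nlinarith [sq_nonneg (|u - r| - δ/3 * (u + 2 * r))]
  unfold negMulLog
  nlinarith

/-- PMF with finite entropy (in nats). -/
def Nice (p : ℤ → ℝ) : Prop := IsPMF p ∧ Summable (fun k => negMulLog (p k))

noncomputable def EN (p : ℤ → ℝ) : ℝ := ∑' k, negMulLog (p k)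

lemma IsPMF.le_one {p : ℤ → ℝ} (hp : IsPMF p) (k : ℤ) : p k ≤ 1 :=
  le_hasSum hp.2 k (fun j _ => hp.1 j)

lemma IsPMF.eta_nonneg {p : ℤ → ℝ} (hp : IsPMF p) (k : ℤ) : 0 ≤ negMulLog (p k) :=
  negMulLog_nonneg (hp.1 k) (hp.le_one k)

/-- (j,k) ↦ (j, k - j) -/
def shearE : ℤ × ℤ ≃ ℤ × ℤ where
  toFun x := (x.1, x.2 - x.1)
  invFun x := (x.1, x.2 + x.1)
  left_inv x := by simp
  right_inv x := by simp

lemma hasSum_shear {f g : ℤ → ℝ} {a b : ℝ} (hf : HasSum f a) (hg : HasSum g b)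
    (f0 : ∀ k, 0 ≤ f k) (g0 : ∀ k, 0 ≤ g k) :
    HasSum (fun x : ℤ × ℤ => f x.1 * g (x.2 - x.1)) (a * b) := by
  have := hf.mul hg (hf.summable.mul_of_nonneg hg.summable f0 g0)
  exact (shearE.hasSum_iff).2 this

lemma hasSum_conv_gen {f g : ℤ → ℝ} {a b : ℝ} (hf : HasSum f a) (hg : HasSum g b)
    (f0 : ∀ k, 0 ≤ f k) (g0 : ∀ k, 0 ≤ g k) :
    (∀ k, HasSum (fun j => f j * g (k - j)) (conv f g k)) ∧ HasSum (conv f g) (a * b) := by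
  have h := hasSum_shear hf hg f0 g0
  have h' : HasSum (fun x : ℤ × ℤ => f x.2 * g (x.1 - x.2)) (a * b) :=
    ((Equiv.prodComm ℤ ℤ).hasSum_iff).2 h
  have hk : ∀ k, HasSum (fun j => f j * g (k - j)) (conv f g k) :=
    fun k => (h'.summable.prod_factor k).hasSum
  exact ⟨hk, h'.prod_fiberwise hk⟩

lemma conv_hasSum {p q : ℤ → ℝ} (hp : IsPMF p) (hq : IsPMF q) (k : ℤ) :
    HasSum (fun j => p j * q (k - j)) (conv p q k) :=
  (hasSum_conv_gen hp.2 hq.2 hp.1 hq.1).1 k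

lemma conv_pmf {p q : ℤ → ℝ} (hp : IsPMF p) (hq : IsPMF q) : IsPMF (conv p q) := by
  refine ⟨fun k => tsum_nonneg fun j => mul_nonneg (hp.1 j) (hq.1 _), ?_⟩
  simpa using (hasSum_conv_gen hp.2 hq.2 hp.1 hq.1).2

lemma conv_ge {p q : ℤ → ℝ} (hp : IsPMF p) (hq : IsPMF q) (k j : ℤ) :
    p j * q (k - j) ≤ conv p q k :=
  le_hasSum (conv_hasSum hp hq k) j (fun i _ => mul_nonneg (hp.1 i) (hq.1 _))

lemma conv_symm (p q : ℤ → ℝ) : conv p q = conv q p := by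
  funext k
  unfold conv
  rw [← (Equiv.subLeft k).tsum_eq (fun j => q j * p (k - j))]
  refine tsum_congr fun j => ?_
  simp [mul_comm]

lemma conv_nice {p q : ℤ → ℝ} (hp : Nice p) (hq : Nice q) : Nice (conv p q) := by
  refine ⟨conv_pmf hp.1 hq.1, ?_⟩
  have h1 := hasSum_conv_gen hp.2.hasSum hq.1.2 hp.1.eta_nonneg hq.1.1
  have h2 := hasSum_conv_gen hp.1.2 hq.2.hasSum hp.1.1 hq.1.eta_nonneg
  refine Summable.of_nonneg_of_le (fun k => (conv_pmf hp.1 hq.1).eta_nonneg k) ?_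
    (h1.2.add h2.2).summable
  intro k
  have h3 := (h1.1 k).add (h2.1 k)
  have h4 := ((conv_hasSum hp.1 hq.1 k).mul_right (-log (conv p q k)))
  have : negMulLog (conv p q k) = conv p q k * (-log (conv p q k)) := by
    unfold negMulLog; ring
  rw [this]
  refine hasSum_le (fun j => ?_) h4 h3
  have e : negMulLog (p j) * q (k - j) + p j * negMulLog (q (k - j)) =
      (p j * q (k-j)) * (- log (p j * q (k - j))) := by
    have := negMulLog_mul (p j) (q (k - j))
    rw [show (p j * q (k-j)) * (- log (p j * q (k - j))) = negMulLog (p j * q (k - j)) by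
      unfold negMulLog; ring, this]
    ring
  rw [e]
  have h5 := mul_nonneg (hp.1.1 j) (hq.1.1 (k - j))
  rcases h5.eq_or_lt with h6 | h6
  · rw [← h6]; simp
  · apply mul_le_mul_of_nonneg_left _ h5
    exact neg_le_neg (log_le_log h6 (conv_ge hp.1 hq.1 k j))

lemma EN_conv_ge {p q : ℤ → ℝ} (hp : Nice p) (hq : Nice q) : EN q ≤ EN (conv p q) := by
  have h2 := hasSum_conv_gen hp.1.2 hq.2.hasSum hp.1.1 hq.1.eta_nonneg
  rw [one_mul] at h2
  refine hasSum_le (fun k => ?_) h2.2 (conv_nice hp hq).2.hasSum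
  set r := conv p q k with hr
  have h3 := conv_hasSum hp.1 hq.1 k
  have h4 : HasSum (fun j => (p j * q (k - j)) * (-log r - 1) + p j * r)
      (r * (-log r - 1) + 1 * r) := (h3.mul_right _).add (hp.1.2.mul_right _)
  have : r * (-log r - 1) + 1 * r = negMulLog r := by unfold negMulLog; ring
  rw [this] at h4
  refine hasSum_le (fun j => ?_) (h2.1 k) h4
  have hpj := hp.1.1 j
  rcases hpj.eq_or_lt with h5 | h5
  · simp [← h5]
  have h6 := pinsker_pt (q (k - j)) r 0 (hq.1.1 _) ((conv_pmf hp.1 hq.1).1 k) (by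
    intro h0
    have := conv_ge hp.1 hq.1 k j
    rw [← hr, h0] at this
    have h7 := hq.1.1 (k - j)
    nlinarith)
  have := mul_le_mul_of_nonneg_left h6 hpj
  nlinarith

lemma mix_nice {U V : ℤ → ℝ} {α : ℝ} (hU : Nice U) (hV : Nice V) {r : ℤ → ℝ} (hr : Nice r)
    (hα : 0 < α) (hα1 : α < 1) (hmix : ∀ k, r k = α * U k + (1 - α) * V k) :
    α * EN U + (1 - α) * EN V + α * (1 - α) / 2 * (∑' k, |U k - V k|) ^ 2 ≤ EN r := by
  have hb : 0 < 1 - α := by linarith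
  set T := ∑' k, |U k - V k| with hT
  have sT : HasSum (fun k => |U k - V k|) T := by
    apply Summable.hasSum
    refine Summable.of_nonneg_of_le (fun k => abs_nonneg _) (fun k => ?_)
      (hU.1.2.add hV.1.2).summable
    have := hU.1.1 k
    have := hV.1.1 k
    rw [abs_le]; constructor <;> linarith
  have r0 : ∀ k, r k = 0 → U k = 0 ∧ V k = 0 := by
    intro k hk
    have h1 := mul_nonneg hα.le (hU.1.1 k)
    have h2 := mul_nonneg hb.le (hV.1.1 k)
    have h3 := hmix k
    constructor
    · have : α * U k = 0 := by linarith
      simpa [hα.ne'] using this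
    · have : (1 - α) * V k = 0 := by linarith
      simpa [hb.ne'] using this
  -- combine pointwise
  have hL : HasSum (fun k => α * (negMulLog (U k) + (1 - α) * T * ((1 - α) * |U k - V k|)
        - ((1 - α) * T) ^ 2 / 6 * (U k + 2 * r k))
      + (1 - α) * (negMulLog (V k) + α * T * (α * |U k - V k|)
        - (α * T) ^ 2 / 6 * (V k + 2 * r k)))
      (α * (EN U + (1 - α) * T * ((1 - α) * T) - ((1 - α) * T) ^ 2 / 6 * (1 + 2 * 1))
      + (1 - α) * (EN V + α * T * (α * T) - (α * T) ^ 2 / 6 * (1 + 2 * 1))) := by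
    refine HasSum.add (HasSum.mul_left _ (HasSum.sub (HasSum.add hU.2.hasSum ?_) ?_))
      (HasSum.mul_left _ (HasSum.sub (HasSum.add hV.2.hasSum ?_) ?_))
    · exact (sT.mul_left _).mul_left _
    · exact (hU.1.2.add (hr.1.2.mul_left 2)).mul_left _
    · exact (sT.mul_left _).mul_left _
    · exact (hV.1.2.add (hr.1.2.mul_left 2)).mul_left _
  have key := hasSum_le (fun k => ?_) hL hr.2.hasSum
  · have e : EN r = ∑' k, negMulLog (r k) := rfl
    rw [e]
    refine le_trans (le_of_eq ?_) key
    ring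
  · have h1 := pinsker_pt (U k) (r k) ((1 - α) * T) (hU.1.1 k) (hr.1.1 k) (fun h => (r0 k h).1)
    have h2 := pinsker_pt (V k) (r k) (α * T) (hV.1.1 k) (hr.1.1 k) (fun h => (r0 k h).2)
    have e1 : |U k - r k| = (1 - α) * |U k - V k| := by
      rw [hmix, show U k - (α * U k + (1 - α) * V k) = (1 - α) * (U k - V k) by ring, abs_mul,
        abs_of_pos hb]
    have e2 : |V k - r k| = α * |U k - V k| := by
      rw [hmix, show V k - (α * U k + (1 - α) * V k) = -(α * (U k - V k)) by ring, abs_neg,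
        abs_mul, abs_of_pos hα]
    rw [e1] at h1
    rw [e2] at h2
    have h3 := mul_le_mul_of_nonneg_left h1 hα.le
    have h4 := mul_le_mul_of_nonneg_left h2 hb.le
    refine (add_le_add h3 h4).trans (le_of_eq ?_)
    have : negMulLog (r k) = -(α * U k + (1 - α) * V k) * log (r k) := by
      rw [← hmix]; rfl
    rw [this]
    have := hmix k
    linear_combination this

lemma nice_restrict {p : ℤ → ℝ} (hp : Nice p) (S : Set ℤ) (α : ℝ) (hα : 0 < α)
    (hS : HasSum (S.indicator p) α) : Nice (fun k => S.indicator p k / α) := by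
  constructor
  · refine ⟨fun k => div_nonneg (Set.indicator_nonneg (fun j _ => hp.1.1 j) k) hα.le, ?_⟩
    simpa [hα.ne'] using hS.div_const α
  · have h1 : Summable (S.indicator fun k => negMulLog (p k)) := hp.2.indicator S
    have h2 : Summable fun k => S.indicator p k * negMulLog α⁻¹ := hS.summable.mul_right _
    refine ((h1.mul_left α⁻¹).add h2).congr fun k => ?_
    by_cases hk : k ∈ S
    · simp only [Set.indicator_of_mem hk, div_eq_mul_inv]
      rw [negMulLog_mul]
    · simp [Set.indicator_of_notMem hk]

lemma split {p : ℤ → ℝ} (hp : Nice p) (S : Set ℤ) (α : ℝ) (hα : 0 < α) (hα1 : α < 1)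
    (hS : HasSum (S.indicator p) α) :
    ∃ A A' : ℤ → ℝ, Nice A ∧ Nice A' ∧ (∀ k, p k = α * A k + (1 - α) * A' k) ∧
      EN p = negMulLog α + negMulLog (1 - α) + α * EN A + (1 - α) * EN A' ∧
      (∀ k, k ∉ S → A k = 0) ∧ (∀ k, k ∈ S → A' k = 0) := by
  have hb : 0 < 1 - α := by linarith
  have hS' : HasSum (Sᶜ.indicator p) (1 - α) := by
    have := hp.1.2.sub hS
    refine this.congr_fun ?_
    intro k
    by_cases hk : k ∈ S <;> simp [hk]
  have nA := nice_restrict hp S α hα hS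
  have nA' := nice_restrict hp Sᶜ (1 - α) hb hS'
  have hmix : ∀ k, p k = α * (S.indicator p k / α) + (1 - α) * (Sᶜ.indicator p k / (1 - α)) := by
    intro k
    rw [mul_div_cancel₀ _ hα.ne', mul_div_cancel₀ _ hb.ne']
    by_cases hk : k ∈ S <;> simp [hk]
  refine ⟨_, _, nA, nA', hmix, ?_, fun k hk => by simp [hk], fun k hk => by simp [hk]⟩
  have h := (((nA.1.2.mul_right (negMulLog α)).add (nA'.1.2.mul_right (negMulLog (1 - α)))).add
    (nA.2.hasSum.mul_left α)).add (nA'.2.hasSum.mul_left (1 - α))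
  rw [one_mul, one_mul] at h
  refine HasSum.tsum_eq (h.congr_fun ?_)
  intro k
  by_cases hk : k ∈ S
  · have e : p k = α * (S.indicator p k / α) := by
      rw [mul_div_cancel₀ _ hα.ne']; simp [hk]
    rw [e, negMulLog_mul]; simp [hk]
  · have e : p k = (1 - α) * (Sᶜ.indicator p k / (1 - α)) := by
      rw [mul_div_cancel₀ _ hb.ne']; simp [hk]
    rw [e, negMulLog_mul]; simp [hk]

lemma conv_mix {p A A' q : ℤ → ℝ} {α : ℝ} (hA : IsPMF A) (hA' : IsPMF A') (hq : IsPMF q)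
    (hmix : ∀ k, p k = α * A k + (1 - α) * A' k) (k : ℤ) :
    conv p q k = α * conv A q k + (1 - α) * conv A' q k := by
  refine HasSum.tsum_eq ?_
  have := ((conv_hasSum hA hq k).mul_left α).add ((conv_hasSum hA' hq k).mul_left (1 - α))
  refine this.congr_fun fun j => ?_
  rw [hmix]; ring

lemma EN_conv_ge' {p q : ℤ → ℝ} (hp : Nice p) (hq : Nice q) : EN p ≤ EN (conv p q) := by
  rw [conv_symm]; exact EN_conv_ge hq hp

lemma first_bound {p q : ℤ → ℝ} (hp : Nice p) (hq : Nice q) (i : ℤ) :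
    p i * EN q + EN p - (negMulLog (p i) + negMulLog (1 - p i)) ≤ EN (conv p q) := by
  rcases (hp.1.1 i).eq_or_lt with h0 | h0
  · rw [← h0]; simpa using EN_conv_ge' hp hq
  have hs : HasSum (({i} : Set ℤ).indicator p) (p i) := by
    have := hasSum_single (f := ({i} : Set ℤ).indicator p) i (by
      intro j hj; simp [hj])
    simpa using this
  rcases (hp.1.le_one i).eq_or_lt with h1 | h1
  · have hE : EN p = 0 := by
      have hz : ∀ k, k ≠ i → p k = 0 := by
        intro k hk
        have := hp.1.2.sub hs
        rw [h1, sub_self] at this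
        have h2 := le_hasSum this k (fun j _ => by
          by_cases hj : j = i
          · simp [hj]
          · simp [hj, hp.1.1 j])
        simp [hk] at h2
        exact le_antisymm h2 (hp.1.1 k)
      unfold EN
      rw [tsum_eq_single i (fun k hk => by rw [hz k hk]; simp), h1]; simp
    rw [h1, hE]; simpa using EN_conv_ge hp hq
  obtain ⟨A, A', nA, nA', hmix, hE, hA0, hA0'⟩ := split hp {i} (p i) h0 h1 hs
  have hEA : EN A = 0 := by
    have e : A i = 1 := by
      have := hmix i
      rw [hA0' i rfl] at this
      have : p i * (A i - 1) = 0 := by linarith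
      rcases mul_eq_zero.1 this with h | h <;> linarith
    unfold EN
    rw [tsum_eq_single i (fun k hk => by rw [hA0 k hk]; simp), e]; simp
  have h2 := mix_nice (conv_nice nA hq) (conv_nice nA' hq) (conv_nice hp hq) h0 h1
    (conv_mix nA.1 nA'.1 hq.1 hmix)
  have h3 := EN_conv_ge nA hq
  have h4 := EN_conv_ge' nA' hq
  have h5 := mul_le_mul_of_nonneg_left h3 h0.le
  have h6 := mul_le_mul_of_nonneg_left h4 (sub_nonneg.2 h1.le)
  have h7 : 0 ≤ p i * (1 - p i) / 2 * (∑' k, |conv A q k - conv A' q k|) ^ 2 := by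
    have := sub_nonneg.2 h1.le
    positivity
  rw [hE, hEA]
  linarith

/-- bilinear pairing -/
noncomputable def bil (f : ℤ → ℝ) (p q : ℤ → ℝ) : ℝ := ∑' k, f k * conv p q k

lemma bil_hasSum {f p q : ℤ → ℝ} (hf : ∀ k, |f k| ≤ 1) (hp : IsPMF p) (hq : IsPMF q) :
    HasSum (fun k => f k * conv p q k) (bil f p q) := by
  apply Summable.hasSum
  refine Summable.of_norm_bounded (conv_pmf hp hq).2.summable fun k => ?_
  rw [norm_mul, norm_eq_abs, norm_eq_abs, abs_of_nonneg ((conv_pmf hp hq).1 k)]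
  exact mul_le_of_le_one_left ((conv_pmf hp hq).1 k) (hf k)

lemma bil_le_one {f p q : ℤ → ℝ} (hf : ∀ k, |f k| ≤ 1) (hp : IsPMF p) (hq : IsPMF q) :
    bil f p q ≤ 1 := by
  refine hasSum_le (fun k => ?_) (bil_hasSum hf hp hq) (conv_pmf hp hq).2
  exact mul_le_of_le_one_left ((conv_pmf hp hq).1 k) (abs_le.1 (hf k)).2

lemma bil_neg (f p q : ℤ → ℝ) : bil (fun k => -f k) p q = - bil f p q := by
  unfold bil; rw [← tsum_neg]; simp

lemma bil_ge_neg_one {f p q : ℤ → ℝ} (hf : ∀ k, |f k| ≤ 1) (hp : IsPMF p) (hq : IsPMF q) :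
    -1 ≤ bil f p q := by
  have := bil_le_one (f := fun k => - f k) (by simpa using hf) hp hq
  rw [bil_neg] at this; linarith

lemma bil_symm (f p q : ℤ → ℝ) : bil f p q = bil f q p := by
  unfold bil; rw [conv_symm]

lemma bil_mix {f p A A' q : ℤ → ℝ} {α : ℝ} (hf : ∀ k, |f k| ≤ 1) (hA : IsPMF A) (hA' : IsPMF A')
    (hq : IsPMF q) (hmix : ∀ k, p k = α * A k + (1 - α) * A' k) :
    bil f p q = α * bil f A q + (1 - α) * bil f A' q := by
  refine HasSum.tsum_eq ?_
  have := ((bil_hasSum hf hA hq).mul_left α).add ((bil_hasSum hf hA' hq).mul_left (1 - α))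
  refine this.congr_fun fun j => ?_
  rw [conv_mix hA hA' hq hmix]; ring

lemma bil_eq_one {f p q : ℤ → ℝ} (hp : IsPMF p) (hq : IsPMF q)
    (h : ∀ i j, p i ≠ 0 → q j ≠ 0 → f (i + j) = 1) : bil f p q = 1 := by
  refine HasSum.tsum_eq ?_
  convert (conv_pmf hp hq).2 using 2 with k
  by_cases h0 : conv p q k = 0
  · simp [h0]
  · have : ∃ j, p j * q (k - j) ≠ 0 := by
      by_contra hc
      push Not at hc
      exact h0 (by unfold conv; simp [hc])
    obtain ⟨j, hj⟩ := this
    have := h j (k - j) (left_ne_zero_of_mul hj) (right_ne_zero_of_mul hj)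
    rw [add_sub_cancel] at this
    rw [this, one_mul]

lemma bil_eq_neg_one {f p q : ℤ → ℝ} (hp : IsPMF p) (hq : IsPMF q)
    (h : ∀ i j, p i ≠ 0 → q j ≠ 0 → f (i + j) = -1) : bil f p q = -1 := by
  have := bil_eq_one (f := fun k => - f k) hp hq (fun i j hi hj => by rw [h i j hi hj]; simp)
  rw [bil_neg] at this; linarith

lemma bil_ge_atom {f p q : ℤ → ℝ} (hf : ∀ k, |f k| ≤ 1) (hp : IsPMF p) (hq : IsPMF q) (l : ℤ)
    (h : ∀ i, p i ≠ 0 → f (i + l) = 1) : 2 * q l - 1 ≤ bil f p q := by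
  have h1 := (bil_hasSum hf hp hq).add (conv_pmf hp hq).2
  have h2 : HasSum (fun k => 2 * (q l * p (k - l))) (2 * (q l * 1)) := by
    have : HasSum (fun k => p (k - l)) 1 := ((Equiv.subRight l).hasSum_iff).2 hp.2
    exact (this.mul_left _).mul_left _
  have := hasSum_le (fun k => ?_) h2 h1
  · linarith
  · have hge := conv_ge hp hq k (k - l)
    rw [sub_sub_cancel] at hge
    have h3 := (abs_le.1 (hf k)).1
    by_cases h0 : p (k - l) = 0
    · rw [h0]
      have := (conv_pmf hp hq).1 k
      nlinarith
    · have := h _ h0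
      rw [sub_add_cancel] at this
      rw [this]; nlinarith

noncomputable def tv (A A' q : ℤ → ℝ) : ℝ := ∑' k, |conv A q k - conv A' q k|

lemma tv_ge {f A A' q : ℤ → ℝ} (hf : ∀ k, |f k| ≤ 1) (hA : IsPMF A) (hA' : IsPMF A')
    (hq : IsPMF q) : bil f A q - bil f A' q ≤ tv A A' q := by
  have h1 := (bil_hasSum hf hA hq).sub (bil_hasSum hf hA' hq)
  have h2 : Summable (fun k => |conv A q k - conv A' q k|) :=
    ((conv_pmf hA hq).2.sub (conv_pmf hA' hq).2).summable.abs
  refine hasSum_le (fun k => ?_) h1 h2.hasSum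
  rw [← mul_sub]
  refine (le_abs_self _).trans ?_
  rw [abs_mul]
  exact mul_le_of_le_one_left (abs_nonneg _) (hf k)

lemma tv_nonneg (A A' q : ℤ → ℝ) : 0 ≤ tv A A' q := tsum_nonneg fun _ => abs_nonneg _

lemma tv_ge_atom {A A' q : ℤ → ℝ} (S : Set ℤ) (hA : IsPMF A) (hA' : IsPMF A')
    (hq : IsPMF q) (l : ℤ) (h : ∀ k, k ∉ S → A k = 0) (h' : ∀ k, k ∈ S → A' k = 0) :
    4 * q l - 2 ≤ tv A A' q := by
  classical
  set f : ℤ → ℝ := fun k => if k - l ∈ S then 1 else -1 with hfdef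
  have hf : ∀ k, |f k| ≤ 1 := by
    intro k; simp only [hfdef]; split_ifs <;> simp
  have h1 := bil_ge_atom hf hA hq l (by
    intro i hi
    have : i ∈ S := by by_contra hc; exact hi (h i hc)
    simp [hfdef, this])
  have h2 := bil_ge_atom (f := fun k => - f k) (by simpa using hf) hA' hq l (by
    intro i hi
    have : i ∉ S := fun hc => hi (h' i hc)
    simp [hfdef, this])
  rw [bil_neg] at h2
  have := tv_ge hf hA hA' hq
  linarith

lemma tv_add {p q A A' B B' : ℤ → ℝ} {α β : ℝ} (m n : ℤ)
    (hA : IsPMF A) (hA' : IsPMF A') (hB : IsPMF B) (hB' : IsPMF B')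
    (hp : IsPMF p) (hq : IsPMF q)
    (hpm : ∀ k, p k = α * A k + (1 - α) * A' k) (hqm : ∀ k, q k = β * B k + (1 - β) * B' k)
    (a : ∀ k, k ∉ Set.Iic m → A k = 0) (a' : ∀ k, k ∈ Set.Iic m → A' k = 0)
    (b : ∀ k, k ∉ Set.Iic n → B k = 0) (b' : ∀ k, k ∈ Set.Iic n → B' k = 0) :
    2 - 2 * |1 - α - β| ≤ tv A A' q + tv B B' p := by
  set f : ℤ → ℝ := fun k => if k ≤ m + n then 1 else -1 with hfdef
  have hf : ∀ k, |f k| ≤ 1 := by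
    intro k; simp only [hfdef]; split_ifs <;> simp
  have mA : ∀ i, A i ≠ 0 → i ≤ m := fun i hi => by by_contra hc; exact hi (a i hc)
  have mA' : ∀ i, A' i ≠ 0 → m < i := fun i hi => by
    by_contra hc; exact hi (a' i (not_lt.1 hc))
  have mB : ∀ i, B i ≠ 0 → i ≤ n := fun i hi => by by_contra hc; exact hi (b i hc)
  have mB' : ∀ i, B' i ≠ 0 → n < i := fun i hi => by
    by_contra hc; exact hi (b' i (not_lt.1 hc))
  have e1 : bil f A B = 1 := bil_eq_one hA hB (fun i j hi hj => by
    have := mA i hi; have := mB j hj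
    simp only [hfdef]; rw [if_pos (by omega)])
  have e2 : bil f A' B' = -1 := bil_eq_neg_one hA' hB' (fun i j hi hj => by
    have := mA' i hi; have := mB' j hj
    simp only [hfdef]; rw [if_neg (by omega)])
  have t1 := tv_ge hf hA hA' hq
  have t2 := tv_ge hf hB hB' hp
  rw [bil_symm f A q, bil_symm f A' q, bil_mix hf hB hB' hA hqm, bil_mix hf hB hB' hA' hqm] at t1
  rw [bil_symm f B p, bil_symm f B' p, bil_mix hf hA hA' hB hpm, bil_mix hf hA hA' hB' hpm] at t2
  rw [bil_symm f B A, bil_symm f B' A', bil_symm f B' A, bil_symm f B A'] at t1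
  rw [e1, e2] at t1 t2
  have u1 := bil_le_one hf hA hB'
  have u2 := bil_ge_neg_one hf hA hB'
  have v1 := bil_le_one hf hA' hB
  have v2 := bil_ge_neg_one hf hA' hB
  have w : |(1 - α - β) * (bil f A B' + bil f A' B)| ≤ |1 - α - β| * 2 := by
    rw [abs_mul]
    apply mul_le_mul_of_nonneg_left _ (abs_nonneg _)
    rw [abs_le]; constructor <;> linarith
  have w' := (abs_le.1 w).1
  nlinarith

lemma exists_max {p : ℤ → ℝ} (hp : IsPMF p) : ∃ i, 0 < p i ∧ ∀ k, p k ≤ p i := by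
  have : ∃ k, 0 < p k := by
    by_contra hc
    push Not at hc
    have : p = fun _ => 0 := funext fun k => le_antisymm (hc k) (hp.1 k)
    have h := hp.2
    rw [this] at h
    exact one_ne_zero (h.unique hasSum_zero)
  obtain ⟨k, hk⟩ := this
  have hfin : {j | p k ≤ p j}.Finite := by
    have := hp.2.summable.tendsto_cofinite_zero.eventually (gt_mem_nhds hk)
    rw [Filter.eventually_cofinite] at this
    simpa using this
  obtain ⟨i, hi, hmax⟩ := Set.exists_max_image _ p hfin ⟨k, le_refl (p k)⟩
  have hi' : p k ≤ p i := hi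
  refine ⟨i, lt_of_lt_of_le hk hi', fun j => ?_⟩
  by_cases hj : p k ≤ p j
  · exact hmax j hj
  · linarith

lemma exists_cut {p : ℤ → ℝ} (hp : IsPMF p) (x : ℝ) (hx : ∀ k, p k ≤ x)
    (hx1 : x < 1) : ∃ m : ℤ, ∃ α, HasSum ((Set.Iic m).indicator p) α ∧
      (1 - x) / 2 ≤ α ∧ α ≤ (1 + x) / 2 := by
  have hsum : ∀ m : ℤ, Summable ((Set.Iic m).indicator p) := fun m => hp.2.summable.indicator _
  set F : ℤ → ℝ := fun m => ∑' k, (Set.Iic m).indicator p k with hF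
  have hb : ∀ m k, ‖(Set.Iic m).indicator p k‖ ≤ p k := by
    intro m k
    by_cases hk : k ∈ Set.Iic m
    · rw [Set.indicator_of_mem hk, norm_of_nonneg (hp.1 k)]
    · rw [Set.indicator_of_notMem hk]; simpa using hp.1 k
  have htop : Filter.Tendsto F Filter.atTop (nhds 1) := by
    rw [← hp.2.tsum_eq]
    refine tendsto_tsum_of_dominated_convergence hp.2.summable (fun k => ?_)
      (Filter.Eventually.of_forall fun m => hb m)
    refine tendsto_const_nhds.congr' ?_
    filter_upwards [Filter.eventually_ge_atTop k] with m hm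
    simp [hm]
  have hbot : Filter.Tendsto F Filter.atBot (nhds 0) := by
    rw [← tsum_zero (α := ℝ) (β := ℤ)]
    refine tendsto_tsum_of_dominated_convergence hp.2.summable (fun k => ?_)
      (Filter.Eventually.of_forall fun m => hb m)
    refine tendsto_const_nhds.congr' ?_
    filter_upwards [Filter.eventually_lt_atBot k] with m hm
    simp [hm]
  have hx0 : 0 ≤ x := (hp.1 0).trans (hx 0)
  obtain ⟨m1, hm1⟩ := (htop.eventually (lt_mem_nhds (show (1 - x) / 2 < 1 by linarith))).exists
  obtain ⟨m0, hm0⟩ := Filter.eventually_atBot.1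
    (hbot.eventually (gt_mem_nhds (show 0 < (1 - x) / 2 by linarith)))
  obtain ⟨m, hm, hleast⟩ := Int.exists_least_of_bdd (P := fun m => (1 - x) / 2 ≤ F m)
    ⟨m0, fun z hz => by
      by_contra hc
      have := hm0 z (by omega)
      linarith⟩ ⟨m1, hm1.le⟩
  refine ⟨m, F m, (hsum m).hasSum, hm, ?_⟩
  have h1 : F (m - 1) < (1 - x) / 2 := by
    by_contra hc
    have := hleast (m - 1) (not_lt.1 hc)
    omega
  have h2 : HasSum (({m} : Set ℤ).indicator p) (p m) := by
    have := hasSum_single (f := ({m} : Set ℤ).indicator p) m (by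
      intro j hj; simp [hj])
    simpa using this
  have h3 : F m = F (m - 1) + p m := by
    refine HasSum.tsum_eq ?_
    convert (hsum (m - 1)).hasSum.add h2 using 2 with k
    rcases lt_trichotomy k m with h | h | h
    · simp [Set.indicator, h.le, h.ne, show k ≤ m - 1 by omega]
    · subst h; simp [Set.indicator]
    · simp [Set.indicator, not_le.2 h, h.ne', show ¬ k ≤ m - 1 by omega]
  linarith [hx m]

lemma second_bound {p q : ℤ → ℝ} (hp : Nice p) (hq : Nice q) (x : ℝ) (hx : ∀ k, p k ≤ x)
    (hx1 : x < 1) : ∃ (m : ℤ) (α : ℝ) (A A' : ℤ → ℝ), IsPMF A ∧ IsPMF A' ∧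
      (1 - x) / 2 ≤ α ∧ α ≤ (1 + x) / 2 ∧
      (∀ k, p k = α * A k + (1 - α) * A' k) ∧
      (∀ k, k ∉ Set.Iic m → A k = 0) ∧ (∀ k, k ∈ Set.Iic m → A' k = 0) ∧
      EN q + (1 - x) ^ 2 * tv A A' q ^ 2 / 8 ≤ EN (conv p q) := by
  obtain ⟨m, α, hS, h1, h2⟩ := exists_cut hp.1 x hx hx1
  have hx0 : 0 ≤ x := (hp.1.1 0).trans (hx 0)
  have hα : 0 < α := by linarith
  have hα1 : α < 1 := by linarith
  obtain ⟨A, A', nA, nA', hmix, hE, hA0, hA0'⟩ := split hp _ α hα hα1 hS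
  refine ⟨m, α, A, A', nA.1, nA'.1, h1, h2, hmix, hA0, hA0', ?_⟩
  have h := mix_nice (conv_nice nA hq) (conv_nice nA' hq) (conv_nice hp hq) hα hα1
    (conv_mix nA.1 nA'.1 hq.1 hmix)
  have h5 := mul_le_mul_of_nonneg_left (EN_conv_ge nA hq) hα.le
  have h6 := mul_le_mul_of_nonneg_left (EN_conv_ge nA' hq) (sub_nonneg.2 hα1.le)
  have e : (∑' k, |conv A q k - conv A' q k|) = tv A A' q := rfl
  rw [e] at h
  have h7 : (1 - x) ^ 2 / 4 ≤ α * (1 - α) := by nlinarith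
  have h8 := mul_le_mul_of_nonneg_right h7 (sq_nonneg (tv A A' q))
  linarith

lemma second_final {p q : ℤ → ℝ} (hp : Nice p) (hq : Nice q) (i l : ℤ)
    (hi : ∀ k, p k ≤ p i) (hl : ∀ k, q k ≤ q l) :
    ∃ ab ∈ Tset (p i) (q l), EN p + EN q +
      ((1 - p i) ^ 2 * ab.1 ^ 2 + (1 - q l) ^ 2 * ab.2 ^ 2) / 8 ≤ 2 * EN (conv p q) := by
  have hp1 := hp.1.le_one i
  have hq1 := hq.1.le_one l
  have hp0 := hp.1.1 i
  have hq0 := hq.1.1 l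
  have g1 := EN_conv_ge hp hq
  have g2 := EN_conv_ge' hp hq
  rcases hp1.eq_or_lt with h1 | h1 <;> rcases hq1.eq_or_lt with h2 | h2
  · refine ⟨(4, 4), ?_, ?_⟩
    · rw [h1, h2]; norm_num [Tset]
    · rw [h1, h2]; norm_num; linarith
  · obtain ⟨n, β, B, B', hB, hB', c1, c2, hmix, b, b', hh⟩ := second_bound hq hp (q l) hl h2
    rw [conv_symm] at hh
    have t := tv_ge_atom _ hB hB' hp.1 i b b'
    have t0 := tv_nonneg B B' p
    refine ⟨(4, tv B B' p), ?_, ?_⟩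
    · refine ⟨by norm_num, t0, max_le ?_ (by norm_num), max_le t t0, ?_⟩
      · show 4 * q l - 2 ≤ 4
        linarith
      · show 2 - p i - q l ≤ 4 + tv B B' p
        linarith
    · rw [h1]; simp only [sub_self]; linarith
  · obtain ⟨n, β, B, B', hB, hB', c1, c2, hmix, b, b', hh⟩ := second_bound hp hq (p i) hi h1
    have t := tv_ge_atom _ hB hB' hq.1 l b b'
    have t0 := tv_nonneg B B' q
    refine ⟨(tv B B' q, 4), ?_, ?_⟩
    · refine ⟨t0, by norm_num, max_le t t0, max_le ?_ (by norm_num), ?_⟩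
      · show 4 * p i - 2 ≤ 4
        linarith
      · show 2 - p i - q l ≤ tv B B' q + 4
        linarith
    · rw [h2]; simp only [sub_self]; linarith
  · obtain ⟨m, α, A, A', hA, hA', d1, d2, hmix', a, a', hh'⟩ := second_bound hp hq (p i) hi h1
    obtain ⟨n, β, B, B', hB, hB', c1, c2, hmix, b, b', hh⟩ := second_bound hq hp (q l) hl h2
    rw [conv_symm] at hh
    have t := tv_ge_atom _ hB hB' hp.1 i b b'
    have t0 := tv_nonneg B B' p
    have s := tv_ge_atom _ hA hA' hq.1 l a a'
    have s0 := tv_nonneg A A' q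
    have st := tv_add m n hA hA' hB hB' hp.1 hq.1 hmix' hmix a a' b b'
    have habs : |1 - α - β| ≤ (p i + q l) / 2 := by
      rw [abs_le]; constructor <;> linarith
    refine ⟨(tv A A' q, tv B B' p), ⟨s0, t0, max_le s s0, max_le t t0, ?_⟩, ?_⟩
    · show 2 - p i - q l ≤ tv A A' q + tv B B' p
      linarith
    · show _ + ((1 - p i) ^ 2 * tv A A' q ^ 2 + (1 - q l) ^ 2 * tv B B' p ^ 2) / 8 ≤ _
      linarith

lemma eta_bits (t : ℝ) : -(t * logb 2 t) = negMulLog t / log 2 := by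
  unfold logb negMulLog; ring

lemma H2_eq (x : ℝ) : H2 x = (negMulLog x + negMulLog (1 - x)) / log 2 := by
  unfold H2 logb negMulLog; ring

lemma nice_of {p : ℤ → ℝ} {c : ℝ} (hp : IsPMF p)
    (hc : HasSum (fun k => -(p k * logb 2 (p k))) c) : Nice p ∧ EN p = c * log 2 := by
  have hl : log 2 ≠ 0 := (log_pos one_lt_two).ne'
  have : HasSum (fun k => negMulLog (p k)) (c * log 2) := by
    refine (hc.mul_right (log 2)).congr_fun fun k => ?_
    rw [eta_bits]; field_simp
  exact ⟨⟨hp, this.summable⟩, this.tsum_eq⟩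

lemma lfun_bddBelow (x y : ℝ) : ∀ z ∈ ((fun ab : ℝ × ℝ =>
    ((1 - x) ^ 2 * ab.1 ^ 2 + (1 - y) ^ 2 * ab.2 ^ 2) / (8 * Real.log 2)) '' Tset x y), 0 ≤ z := by
  rintro z ⟨ab, _, rfl⟩
  have : 0 < log 2 := log_pos one_lt_two
  positivity

/-- if `p₁, p₂` are probability distributions on `ℤ` with finite entropies
`H(p₁) = c` and `H(p₂) = d`, then `H(p₁⋆p₂) − (c+d)/2 ≥ g(c,d)`. -/
theorem stmt3 (p₁ p₂ : ℤ → ℝ) (c d : ℝ) (hp₁ : IsPMF p₁) (hp₂ : IsPMF p₂)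
    (hc : HasSum (fun k => -(p₁ k * Real.logb 2 (p₁ k))) c)
    (hd : HasSum (fun k => -(p₂ k * Real.logb 2 (p₂ k))) d) :
    entH (conv p₁ p₂) - (c + d) / 2 ≥ gNIID c d := by
  have hl : 0 < log 2 := log_pos one_lt_two
  obtain ⟨n1, e1⟩ := nice_of hp₁ hc
  obtain ⟨n2, e2⟩ := nice_of hp₂ hd
  obtain ⟨i, _, hi⟩ := exists_max hp₁
  obtain ⟨l, _, hl'⟩ := exists_max hp₂
  have eR : entH (conv p₁ p₂) = EN (conv p₁ p₂) / log 2 := by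
    unfold entH EN
    rw [← tsum_div_const]
    exact tsum_congr fun k => eta_bits _
  have b1 := first_bound n1 n2 i
  have b2 := first_bound n2 n1 l
  rw [conv_symm] at b2
  obtain ⟨ab, hab, b3⟩ := second_final n1 n2 i l hi hl'
  set R := EN (conv p₁ p₂) with hR
  have hg : gNIID c d ≤ (1 / 2) * max (d * p₁ i - H2 (p₁ i) + c * p₂ l - H2 (p₂ l))
      (lfun (p₁ i) (p₂ l)) := by
    unfold gNIID
    apply mul_le_mul_of_nonneg_left _ (by norm_num)
    apply csInf_le
    · refine ⟨0, ?_⟩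
      rintro z ⟨xy, _, rfl⟩
      exact le_max_of_le_right (Real.sInf_nonneg (lfun_bddBelow _ _))
    · exact ⟨(p₁ i, p₂ l), ⟨⟨hp₁.1 i, hp₁.le_one i⟩, ⟨hp₂.1 l, hp₂.le_one l⟩⟩, rfl⟩
  have hlf : lfun (p₁ i) (p₂ l) ≤
      ((1 - p₁ i) ^ 2 * ab.1 ^ 2 + (1 - p₂ l) ^ 2 * ab.2 ^ 2) / (8 * Real.log 2) :=
    csInf_le ⟨0, fun z hz => lfun_bddBelow _ _ z hz⟩ ⟨ab, hab, rfl⟩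
  have hmain : max (d * p₁ i - H2 (p₁ i) + c * p₂ l - H2 (p₂ l))
      (lfun (p₁ i) (p₂ l)) ≤ 2 * (R / log 2) - (c + d) := by
    have er : 2 * (R / log 2) - (c + d) = (2 * R - (EN p₁ + EN p₂)) / log 2 := by
      rw [e1, e2]; field_simp
    rw [er]
    apply max_le
    · rw [le_div_iff₀ hl, H2_eq, H2_eq]
      have : (d * p₁ i - (negMulLog (p₁ i) + negMulLog (1 - p₁ i)) / log 2 + c * p₂ l
          - (negMulLog (p₂ l) + negMulLog (1 - p₂ l)) / log 2) * log 2 =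
          p₁ i * EN p₂ - (negMulLog (p₁ i) + negMulLog (1 - p₁ i)) + p₂ l * EN p₁
          - (negMulLog (p₂ l) + negMulLog (1 - p₂ l)) := by
        rw [e1, e2]; field_simp; try ring
      rw [this]
      linarith
    · refine hlf.trans ?_
      rw [← div_div]
      apply div_le_div_of_nonneg_right _ hl.le
      linarith
  rw [eR]
  linarith
end

section
/- Let M ≥ 1 and N ≥ 2 be integers, let p₁ be the uniform distribution on {1,2,…,M} and p₂ the uniform distribution on {1,2,…,NM}. Then H(p₁⋆p₂) − max{H(p₁), H(p₂)} ≤ log₂((N+1)/N). -/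
lemma aux_pt (x K : ℝ) (hx : 0 ≤ x) (hK : 0 < K) :
    -(x * Real.log x) ≤ x * Real.log K + 1 / K - x := by
  rcases hx.eq_or_lt with h | h
  · subst h; simp; positivity
  · have h1 := Real.log_le_sub_one_of_pos (show 0 < 1 / (K * x) by positivity)
    rw [Real.log_div one_ne_zero (by positivity), Real.log_mul hK.ne' h.ne', Real.log_one] at h1
    have h2 := mul_le_mul_of_nonneg_left h1 h.le
    have h3 : x * (1 / (K * x) - 1) = 1 / K - x := by field_simp
    rw [h3] at h2
    linarith

lemma aux_ent (q : ℤ → ℝ) (S : Finset ℤ) (K : ℝ) (hK : 0 < K) (hc : (S.card : ℝ) = K)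
    (h0 : ∀ k, 0 ≤ q k) (hS : ∀ k, k ∉ S → q k = 0) (h1 : ∑ k ∈ S, q k = 1) :
    entH q ≤ Real.logb 2 K := by
  unfold entH
  rw [tsum_eq_sum (s := S) (fun k hk => by simp [hS k hk])]
  have hl : 0 < Real.log 2 := Real.log_pos (by norm_num)
  have h2 : ∑ k ∈ S, -(q k * Real.log (q k)) ≤ Real.log K := by
    calc _ ≤ ∑ k ∈ S, (q k * Real.log K + 1 / K - q k) :=
          Finset.sum_le_sum fun k _ => aux_pt _ _ (h0 k) hK
      _ = Real.log K := by
          rw [Finset.sum_sub_distrib, Finset.sum_add_distrib, ← Finset.sum_mul, h1,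
            Finset.sum_const, nsmul_eq_mul, hc]
          field_simp
          ring
  have h3 : ∑ k ∈ S, -(q k * Real.logb 2 (q k)) =
      (∑ k ∈ S, -(q k * Real.log (q k))) / Real.log 2 := by
    rw [Finset.sum_div]
    refine Finset.sum_congr rfl fun k _ => ?_
    simp only [Real.logb]; ring
  rw [h3, Real.logb]
  exact div_le_div_of_nonneg_right h2 hl.le

/-- for `p₁` uniform on `{1,…,M}` and `p₂` uniform on `{1,…,NM}` with
`M ≥ 1`, `N ≥ 2`, one has `H(p₁⋆p₂) − max{H(p₁),H(p₂)} ≤ log₂((N+1)/N)`. -/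
theorem stmt5 (M N : ℕ) (hM : 1 ≤ M) (hN : 2 ≤ N) (p₁ p₂ : ℤ → ℝ)
    (hp₁ : ∀ k : ℤ, p₁ k = if 1 ≤ k ∧ k ≤ (M : ℤ) then (1 : ℝ) / M else 0)
    (hp₂ : ∀ k : ℤ, p₂ k = if 1 ≤ k ∧ k ≤ ((N : ℤ) * M) then (1 : ℝ) / (N * M) else 0) :
    entH (conv p₁ p₂) - max (entH p₁) (entH p₂) ≤ Real.logb 2 (((N : ℝ) + 1) / N) := by
  have hM' : (0 : ℝ) < M := by exact_mod_cast hM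
  have hN' : (0 : ℝ) < N := by exact_mod_cast (by omega : 0 < N)
  have hcv : ∀ k, conv p₁ p₂ k = ∑ j ∈ Finset.Icc (1 : ℤ) M, 1 / (M : ℝ) * p₂ (k - j) := by
    intro k
    unfold conv
    rw [tsum_eq_sum (s := Finset.Icc (1 : ℤ) M)]
    · refine Finset.sum_congr rfl fun j hj => ?_
      rw [hp₁, if_pos (Finset.mem_Icc.1 hj)]
    · intro j hj
      rw [hp₁, if_neg (fun h => hj (Finset.mem_Icc.2 h)), zero_mul]
  have hp2n : ∀ k, 0 ≤ p₂ k := by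
    intro k; rw [hp₂]; split_ifs <;> positivity
  have hA : entH (conv p₁ p₂) ≤ Real.logb 2 (((N : ℝ) + 1) * M) := by
    apply aux_ent _ (Finset.Icc (1 : ℤ) ((N : ℤ) * M + M)) _ (by positivity)
    · rw [Int.card_Icc]
      have : ((N : ℤ) * M + M + 1 - 1).toNat = N * M + M := by
        rw [add_sub_cancel_right]; exact_mod_cast Int.toNat_natCast (N * M + M)
      rw [this]; push_cast; ring
    · intro k
      rw [hcv]
      exact Finset.sum_nonneg fun j _ => mul_nonneg (by positivity) (hp2n _)
    · intro k hk
      rw [hcv]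
      refine Finset.sum_eq_zero fun j hj => ?_
      rw [Finset.mem_Icc] at hk hj
      rw [hp₂, if_neg, mul_zero]
      rintro ⟨h1, h2⟩
      apply hk
      constructor <;> linarith [hj.1, hj.2]
    · simp_rw [hcv]
      rw [Finset.sum_comm]
      have : ∀ j ∈ Finset.Icc (1 : ℤ) M,
          ∑ k ∈ Finset.Icc (1 : ℤ) ((N : ℤ) * M + M), 1 / (M : ℝ) * p₂ (k - j) = 1 / (M : ℝ) := by
        intro j hj
        rw [Finset.mem_Icc] at hj
        rw [← Finset.mul_sum]
        simp_rw [hp₂]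
        rw [← Finset.sum_filter, Finset.sum_const]
        have hf : (Finset.Icc (1 : ℤ) ((N : ℤ) * M + M)).filter
            (fun k => 1 ≤ k - j ∧ k - j ≤ (N : ℤ) * M) = Finset.Icc (1 + j) ((N : ℤ) * M + j) := by
          ext k
          simp only [Finset.mem_filter, Finset.mem_Icc]
          constructor
          · rintro ⟨_, h1, h2⟩; constructor <;> linarith
          · rintro ⟨h1, h2⟩
            refine ⟨⟨?_, ?_⟩, ?_, ?_⟩ <;> linarith [hj.1, hj.2]
        have hc : ((N : ℤ) * M + j + 1 - (1 + j)).toNat = N * M := by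
          rw [show (N : ℤ) * M + j + 1 - (1 + j) = ((N * M : ℕ) : ℤ) by push_cast; ring]
          exact Int.toNat_natCast _
        rw [hf, Int.card_Icc, hc, nsmul_eq_mul]
        push_cast
        field_simp
      rw [Finset.sum_congr rfl this, Finset.sum_const, Int.card_Icc, nsmul_eq_mul]
      simp
      field_simp
  have hB : entH p₂ = Real.logb 2 ((N : ℝ) * M) := by
    unfold entH
    rw [tsum_eq_sum (s := Finset.Icc (1 : ℤ) ((N : ℤ) * M))]
    · have : ∀ k ∈ Finset.Icc (1 : ℤ) ((N : ℤ) * M), -(p₂ k * Real.logb 2 (p₂ k)) =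
          1 / ((N : ℝ) * M) * Real.logb 2 ((N : ℝ) * M) := by
        intro k hk
        rw [hp₂, if_pos (Finset.mem_Icc.1 hk), one_div, Real.logb_inv]
        ring
      have hc : ((N : ℤ) * M + 1 - 1).toNat = N * M := by
        rw [add_sub_cancel_right]; exact_mod_cast Int.toNat_natCast (N * M)
      rw [Finset.sum_congr rfl this, Finset.sum_const, Int.card_Icc, nsmul_eq_mul, hc]
      push_cast
      field_simp
    · intro k hk
      rw [hp₂, if_neg (fun h => hk (Finset.mem_Icc.2 h))]
      simp
  have hC : Real.logb 2 (((N : ℝ) + 1) / N) =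
      Real.logb 2 (((N : ℝ) + 1) * M) - Real.logb 2 ((N : ℝ) * M) := by
    rw [← Real.logb_div (by positivity) (by positivity)]
    congr 1
    field_simp
  have := le_max_right (entH p₁) (entH p₂)
  linarith
end

section
/- Let p be a probability distribution on ℤ with finite entropy H(p) = c, and let x = ‖p‖_∞ = max_{i∈ℤ} p(i). Then H(p⋆p) − c ≥ c·x − h₂(x). -/
theorem gibbs_pt (a s b : ℝ) (ha : 0 ≤ a) (hs : 0 ≤ s) (hb : 0 ≤ b) (has : 0 < a → 0 < s)
    (hab : 0 < a → 0 < b) :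
    Real.negMulLog a + a * Real.log s + a - s * b ≤ a * -Real.log b := by
  rcases ha.eq_or_lt with h | h
  · subst h
    simp [mul_nonneg hs hb]
  · have h1 := has h
    have h2 := hab h
    have h3 := Real.log_le_sub_one_of_pos (x := s * b / a) (by positivity)
    rw [Real.log_div (by positivity) (by positivity), Real.log_mul h1.ne' h2.ne'] at h3
    have h4 := mul_le_mul_of_nonneg_left h3 h.le
    have h5 : a * (s * b / a - 1) = s * b - a := by field_simp
    rw [h5] at h4
    unfold Real.negMulLog
    nlinarith

/-- `(k, j) ↦ (j, k - j)`. -/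
def shearZ : ℤ × ℤ ≃ ℤ × ℤ where
  toFun q := (q.2, q.1 - q.2)
  invFun q := (q.1 + q.2, q.1)
  left_inv q := by ext <;> simp
  right_inv q := by ext <;> simp

theorem nat_version (p : ℤ → ℝ) (c : ℝ) (h0 : ∀ k, 0 ≤ p k) (h1 : HasSum p 1)
    (hc : HasSum (fun k => Real.negMulLog (p k)) c) (i : ℤ) :
    c + c * p i - (Real.negMulLog (p i) + Real.negMulLog (1 - p i)) ≤
      ∑' k, Real.negMulLog (conv p p k) := by
  set r := conv p p with hr
  have hpp : Summable (fun q : ℤ × ℤ => p q.1 * p q.2) :=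
    h1.summable.mul_of_nonneg h1.summable h0 h0
  have hpp' : Summable (fun q : ℤ × ℤ => p q.2 * p (q.1 - q.2)) :=
    (shearZ.summable_iff (f := fun q : ℤ × ℤ => p q.1 * p q.2)).2 hpp
  have hrk : ∀ k, HasSum (fun j => p j * p (k - j)) (r k) := fun k =>
    (hpp'.prod_factor k).hasSum
  have hr0 : ∀ k, 0 ≤ r k := fun k => (hrk k).nonneg fun j => mul_nonneg (h0 _) (h0 _)
  have hr1 : HasSum r 1 := by
    have e : ∑' q : ℤ × ℤ, p q.2 * p (q.1 - q.2) = 1 := by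
      refine (shearZ.tsum_eq (fun q : ℤ × ℤ => p q.1 * p q.2)).trans ?_
      rw [hpp.tsum_prod]
      simp [tsum_mul_left, h1.tsum_eq]
    have := hpp'.hasSum.prod_fiberwise hrk
    rwa [e] at this
  have hrle : ∀ k, r k ≤ 1 := fun k => le_hasSum hr1 k fun j _ => hr0 j
  have hpr : ∀ j m, p j * p m ≤ r (j + m) := fun j m => by
    have := le_hasSum (hrk (j + m)) j fun j _ => mul_nonneg (h0 _) (h0 _)
    simpa using this
  have hp1 : ∀ k, p k ≤ 1 := fun k => le_hasSum h1 k fun j _ => h0 j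
  have hL0 : ∀ k, 0 ≤ -Real.log (r k) := fun k =>
    neg_nonneg.2 (Real.log_nonpos (hr0 k) (hrle k))
  have hn0 : ∀ k, 0 ≤ Real.negMulLog (p k) := fun k => Real.negMulLog_nonneg (h0 k) (hp1 k)
  -- summability of the double family
  have hF : Summable (fun q : ℤ × ℤ => p q.1 * p q.2 * -Real.log (r (q.1 + q.2))) := by
    have hb : Summable (fun q : ℤ × ℤ =>
        Real.negMulLog (p q.1) * p q.2 + p q.1 * Real.negMulLog (p q.2)) :=
      (hc.summable.mul_of_nonneg h1.summable hn0 h0).add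
        (h1.summable.mul_of_nonneg hc.summable h0 hn0)
    refine Summable.of_nonneg_of_le
      (fun q => mul_nonneg (mul_nonneg (h0 _) (h0 _)) (hL0 _)) (fun q => ?_) hb
    rcases (h0 q.1).eq_or_lt with h | h
    · simp [← h]
    rcases (h0 q.2).eq_or_lt with h' | h'
    · simp [← h']
    have hl := Real.log_le_log (mul_pos h h') (hpr q.1 q.2)
    rw [Real.log_mul h.ne' h'.ne'] at hl
    have := mul_le_mul_of_nonneg_left hl (mul_pos h h').le
    unfold Real.negMulLog
    nlinarith
  have hF' : Summable (fun q : ℤ × ℤ => p q.2 * p (q.1 - q.2) * -Real.log (r q.1)) := by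
    have := (shearZ.summable_iff
      (f := fun q : ℤ × ℤ => p q.1 * p q.2 * -Real.log (r (q.1 + q.2)))).2 hF
    simpa [shearZ, Function.comp_def] using this
  have hEq : ∑' k, Real.negMulLog (r k) =
      ∑' j, ∑' m, p j * p m * -Real.log (r (j + m)) := by
    rw [← hF.tsum_prod (f := fun q : ℤ × ℤ => p q.1 * p q.2 * -Real.log (r (q.1 + q.2))),
      ← shearZ.tsum_eq]
    have e : (fun q : ℤ × ℤ => p (shearZ q).1 * p (shearZ q).2 *
        -Real.log (r ((shearZ q).1 + (shearZ q).2))) =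
        fun q : ℤ × ℤ => p q.2 * p (q.1 - q.2) * -Real.log (r q.1) := by
      funext q; simp [shearZ]
    rw [e, hF'.tsum_prod]
    refine tsum_congr fun k => ?_
    rw [((hrk k).mul_right (-Real.log (r k))).tsum_eq]
    simp [Real.negMulLog]
  rw [hEq]
  set x := p i with hxdef
  set K := c - (Real.negMulLog x + Real.negMulLog (1 - x)) with hK
  have hx1 : 0 ≤ 1 - x := sub_nonneg.2 (hp1 i)
  -- inner bound
  have hin : ∀ j, x * (Real.negMulLog (p j) + p j - r (j + i)) + p j * K ≤
      ∑' m, p j * p m * -Real.log (r (j + m)) := by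
    intro j
    have hrj : HasSum (fun m => r (j + m)) 1 :=
      ((Equiv.addLeft j).hasSum_iff (f := r)).2 hr1
    have hbase : HasSum (fun m => p j * (Real.negMulLog (p m) + p m * Real.log (1 - x) + p m
        - (1 - x) * r (j + m))) (p j * (c + 1 * Real.log (1 - x) + 1 - (1 - x) * 1)) :=
      (((hc.add (h1.mul_right _)).add h1).sub (hrj.mul_left _)).mul_left _
    have hu := hbase.update i (p j * x * -Real.log (r (j + i)))
    have hle := hasSum_le (fun m => ?_) hu (hF.prod_factor j).hasSum
    · refine le_trans ?_ hle
      have g : Real.negMulLog (p j) + p j * Real.log 1 + p j - 1 * r (j + i) ≤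
          p j * -Real.log (r (j + i)) ∨ x = 0 := by
        rcases (h0 i).eq_or_lt with h | h
        · right; exact h.symm
        · left
          exact gibbs_pt _ _ _ (h0 j) zero_le_one (hr0 _) (fun _ => one_pos)
            (fun h' => lt_of_lt_of_le (mul_pos h' h) (hpr j i))
      have g' : x * (Real.negMulLog (p j) + p j - r (j + i)) ≤
          x * (p j * -Real.log (r (j + i))) := by
        rcases g with g | g
        · refine mul_le_mul_of_nonneg_left ?_ (h0 i)
          simpa using g
        · simp [g]
      have hn : 0 ≤ p j * ((1 - x) * r (j + i)) := mul_nonneg (h0 _) (mul_nonneg hx1 (hr0 _))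
      have hd : Real.negMulLog (1 - x) = -(1 - x) * Real.log (1 - x) := rfl
      rw [hK, hd]
      simp only [← hxdef]
      nlinarith
    · by_cases hm : m = i
      · subst hm; simp [hxdef]
      · rw [Function.update_of_ne hm]
        rcases (h0 j).eq_or_lt with h | h
        · simp [← h]
        rw [mul_assoc]
        refine mul_le_mul_of_nonneg_left ?_ (h0 j)
        refine gibbs_pt _ _ _ (h0 m) hx1 (hr0 _) (fun h' => ?_)
          (fun h' => lt_of_lt_of_le (mul_pos h h') (hpr j m))
        have := sum_le_hasSum {m, i} (fun k _ => h0 k) h1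
        rw [Finset.sum_pair hm] at this
        linarith
  have hri : HasSum (fun j => r (j + i)) 1 :=
    ((Equiv.addRight i).hasSum_iff (f := r)).2 hr1
  have hfin := hasSum_le hin
    ((((hc.add h1).sub hri).mul_left x).add (h1.mul_right K)) hF.prod.hasSum
  linarith

/-- if `p` has finite entropy `H(p) = c` and `x = ‖p‖_∞`, then
`H(p⋆p) − c ≥ c·x − h₂(x)`. -/
theorem stmt7 (p : ℤ → ℝ) (c x : ℝ) (hp : IsPMF p)
    (hc : HasSum (fun k => -(p k * Real.logb 2 (p k))) c)
    (hx : x = ⨆ i, p i) :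
    entH (conv p p) - c ≥ c * x - H2 x := by
  obtain ⟨h0, h1⟩ := hp
  have hl : 0 < Real.log 2 := Real.log_pos (by norm_num)
  have hconv : ∀ t : ℝ, -(t * Real.logb 2 t) = Real.negMulLog t / Real.log 2 := fun t => by
    simp only [Real.logb, Real.negMulLog]; ring
  -- the supremum is attained
  obtain ⟨i, hi⟩ : ∃ i, ∀ k, p k ≤ p i := by
    obtain ⟨k0, hk0⟩ : ∃ k0, 0 < p k0 := by
      by_contra hcon
      push Not at hcon
      have : p = fun _ => 0 := funext fun k => le_antisymm (hcon k) (h0 k)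
      rw [this] at h1
      exact zero_ne_one (hasSum_zero.unique h1)
    have hev := h1.summable.tendsto_cofinite_zero.eventually (gt_mem_nhds hk0)
    rw [Filter.eventually_cofinite] at hev
    obtain ⟨i, hi, hmax⟩ := Set.exists_max_image _ p hev ⟨k0, by simp⟩
    refine ⟨i, fun k => ?_⟩
    by_cases hk : p k < p k0
    · have hi' : ¬ p i < p k0 := hi
      linarith
    · exact hmax k hk
  have hxi : x = p i := by
    rw [hx]
    exact le_antisymm (ciSup_le hi) (le_ciSup ⟨p i, by rintro _ ⟨k, rfl⟩; exact hi k⟩ i)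
  have hc' : HasSum (fun k => Real.negMulLog (p k)) (c * Real.log 2) := by
    have := hc.mul_right (Real.log 2)
    refine this.congr_fun ?_ |> id
    intro k
    rw [hconv]; field_simp
  have key := nat_version p _ h0 h1 hc' i
  have he : entH (conv p p) = (∑' k, Real.negMulLog (conv p p k)) / Real.log 2 := by
    unfold entH
    simp only [hconv, tsum_div_const]
  have hh : H2 x = (Real.negMulLog (p i) + Real.negMulLog (1 - p i)) / Real.log 2 := by
    unfold H2
    rw [sub_eq_add_neg, hconv, hconv, hxi]; ring
  rw [he, hh, hxi, ge_iff_le, ← sub_nonneg]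
  have : (∑' k, Real.negMulLog (conv p p k)) / Real.log 2 - c -
      (c * p i - (Real.negMulLog (p i) + Real.negMulLog (1 - p i)) / Real.log 2) =
      ((∑' k, Real.negMulLog (conv p p k)) - (c * Real.log 2 + c * Real.log 2 * p i -
        (Real.negMulLog (p i) + Real.negMulLog (1 - p i)))) / Real.log 2 := by
    field_simp; ring
  rw [this]
  exact div_nonneg (sub_nonneg.2 key) hl.le
end

section
/- Let 0 < α < 1/2, let n ∈ ℤ, and let p be a probability distribution on ℤ with α ≤ p((−∞,n]) ≤ 1−α. Let p₁ = p|_{(−∞,n]} / p((−∞,n]) and p₂ = p|_{[n+1,∞)} / p([n+1,∞)) be the normalized restrictions of p to (−∞,n] and [n+1,∞). Then ‖p⋆p₁ − p⋆p₂‖₁ ≥ 2α. -/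
/-- `p((−∞,n])`, the total mass of `p` on `(−∞,n]`. -/
noncomputable def headMass (p : ℤ → ℝ) (n : ℤ) : ℝ := ∑' k, if k ≤ n then p k else 0

/-- `p([n+1,∞))`, the total mass of `p` on `[n+1,∞)`. -/
noncomputable def tailMass (p : ℤ → ℝ) (n : ℤ) : ℝ := ∑' k, if n + 1 ≤ k then p k else 0

/-- The normalized restriction `p|_{(−∞,n]} / p((−∞,n])`. -/
noncomputable def headPart (p : ℤ → ℝ) (n : ℤ) : ℤ → ℝ :=
  fun k => if k ≤ n then p k / headMass p n else 0

/-- The normalized restriction `p|_{[n+1,∞)} / p([n+1,∞))`. -/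
noncomputable def tailPart (p : ℤ → ℝ) (n : ℤ) : ℤ → ℝ :=
  fun k => if n + 1 ≤ k then p k / tailMass p n else 0

/-- The `ℓ₁`-distance of two functions on `ℤ`. -/
noncomputable def l1dist (f g : ℤ → ℝ) : ℝ := ∑' k, |f k - g k|

namespace Stmt8Aux

noncomputable def sgn (m k : ℤ) : ℝ := if k ≤ m then 1 else -1

lemma abs_sgn (m k : ℤ) : |sgn m k| = 1 := by unfold sgn; split_ifs <;> simp

def shear : ℤ × ℤ ≃ ℤ × ℤ where
  toFun x := (x.2, x.1 - x.2)
  invFun x := (x.1 + x.2, x.1)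
  left_inv x := by ext <;> simp
  right_inv x := by ext <;> simp

noncomputable def F (m : ℤ) (u v : ℤ → ℝ) (x : ℤ × ℤ) : ℝ := sgn m (x.1 + x.2) * (u x.1 * v x.2)

lemma prod_summable {u v : ℤ → ℝ} (hu : Summable u) (hv : Summable v) :
    Summable (fun x : ℤ × ℤ => u x.1 * v x.2) :=
  summable_mul_of_summable_norm hu.norm hv.norm

lemma F_summable (m : ℤ) {u v : ℤ → ℝ} (hu : Summable u) (hv : Summable v) :
    Summable (F m u v) := by
  refine Summable.of_norm_bounded (prod_summable hu hv).norm ?_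
  intro x
  simp [F, abs_mul, abs_sgn]

lemma tsum_prod' {u v : ℤ → ℝ} (hu : Summable u) (hv : Summable v) :
    ∑' x : ℤ × ℤ, u x.1 * v x.2 = (∑' i, u i) * ∑' j, v j :=
  (hu.tsum_mul_tsum hv (prod_summable hu hv)).symm

lemma conv_summable {u v : ℤ → ℝ} (hu : Summable u) (hv : Summable v) :
    Summable (conv u v) := by
  have h := (shear.summable_iff.2 (prod_summable hu hv))
  exact h.prod

lemma conv_pt {u v : ℤ → ℝ} (hu : Summable u) (hv : Summable v) (k : ℤ) :
    Summable (fun j => u j * v (k - j)) := by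
  have h := (shear.summable_iff.2 (prod_summable hu hv))
  exact h.prod_factor k

lemma tsum_F_le (m : ℤ) {u v : ℤ → ℝ} (hu : Summable u) (hv : Summable v) :
    ∑' x, F m u v x ≤ ∑' k, |conv u v k| := by
  have h : Summable (fun c => F m u v (shear c)) := shear.summable_iff.2 (F_summable m hu hv)
  rw [← shear.tsum_eq, h.tsum_prod]
  refine Summable.tsum_le_tsum ?_ h.prod (conv_summable hu hv).abs
  intro k
  have : ∑' j, F m u v (shear (k, j)) = sgn m k * conv u v k := by
    simp only [F, shear, conv, Equiv.coe_fn_mk, add_sub_cancel]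
    rw [tsum_mul_left]
  change ∑' j, F m u v (shear (k, j)) ≤ _
  rw [this]
  refine (le_abs_self _).trans ?_
  rw [abs_mul, abs_sgn, one_mul]

lemma F_swap (m : ℤ) (u v : ℤ → ℝ) : ∑' x, F m u v x = ∑' x, F m v u x := by
  rw [← (Equiv.prodComm ℤ ℤ).tsum_eq]
  refine tsum_congr fun x => ?_
  simp [F, add_comm, mul_comm]

lemma main (a b : ℝ) (ha : 0 < a) (hb : 0 < b) (n : ℤ) (P Q : ℤ → ℝ)
    (hP0 : ∀ k, 0 ≤ P k) (hQ0 : ∀ k, 0 ≤ Q k) (hP : HasSum P a) (hQ : HasSum Q b)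
    (hPn : ∀ k, n < k → P k = 0) (hQn : ∀ k, k ≤ n → Q k = 0) :
    2 * min a b ≤ ∑' k, |conv (fun k => P k + Q k) (fun k => P k / a - Q k / b) k| := by
  have sP := hP.summable
  have sQ := hQ.summable
  refine le_trans ?_ (tsum_F_le (2 * n) (sP.add sQ) ((sP.div_const a).sub (sQ.div_const b)))
  have e : ∀ x, F (2*n) (fun k => P k + Q k) (fun k => P k / a - Q k / b) x
      = (F (2*n) P P x * a⁻¹ + F (2*n) Q P x * a⁻¹) - (F (2*n) P Q x * b⁻¹ + F (2*n) Q Q x * b⁻¹) := by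
    intro x; simp only [F]; ring
  have PP := F_summable (2*n) sP sP
  have PQ := F_summable (2*n) sP sQ
  have QP := F_summable (2*n) sQ sP
  have QQ := F_summable (2*n) sQ sQ
  rw [tsum_congr e, Summable.tsum_sub ((PP.mul_right _).add (QP.mul_right _))
    ((PQ.mul_right _).add (QQ.mul_right _)), Summable.tsum_add (PP.mul_right _) (QP.mul_right _),
    Summable.tsum_add (PQ.mul_right _) (QQ.mul_right _)]
  simp only [tsum_mul_right]
  rw [F_swap _ Q P]
  have tPP : ∑' x, F (2*n) P P x = a * a := by
    rw [← hP.tsum_eq, ← tsum_prod' sP sP]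
    refine tsum_congr fun x => ?_
    unfold F sgn
    split_ifs with h
    · simp
    · rcases lt_or_ge n x.1 with h1 | h1
      · simp [hPn _ h1]
      · simp [hPn x.2 (by omega)]
  have tQQ : ∑' x, F (2*n) Q Q x = -(b * b) := by
    rw [← hQ.tsum_eq, ← tsum_prod' sQ sQ, ← tsum_neg]
    refine tsum_congr fun x => ?_
    unfold F sgn
    split_ifs with h
    · rcases le_or_gt x.1 n with h1 | h1
      · simp [hQn _ h1]
      · simp [hQn x.2 (by omega)]
    · simp
  have tPQ : |∑' x, F (2*n) P Q x| ≤ a * b := by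
    rw [← hP.tsum_eq, ← hQ.tsum_eq, ← tsum_prod' sP sQ]
    refine (norm_tsum_le_tsum_norm PQ.norm).trans (le_of_eq ?_)
    refine tsum_congr fun x => ?_
    simp [F, abs_mul, abs_sgn, abs_of_nonneg (hP0 _), abs_of_nonneg (hQ0 _)]
  rw [tPP, tQQ]
  generalize (∑' x, F (2*n) P Q x) = t at tPQ ⊢
  have key : a * a * a⁻¹ + t * a⁻¹ - (t * b⁻¹ + -(b * b) * b⁻¹) = a + b + t * (b - a) / (a * b) := by
    field_simp; ring
  rw [key]
  obtain ⟨t1, t2⟩ := abs_le.1 tPQ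
  have hab := mul_pos ha hb
  rcases le_total a b with h | h
  · rw [min_eq_left h]
    have : a - b ≤ t * (b - a) / (a * b) := by
      rw [le_div_iff₀ hab]; nlinarith
    linarith
  · rw [min_eq_right h]
    have : b - a ≤ t * (b - a) / (a * b) := by
      rw [le_div_iff₀ hab]; nlinarith
    linarith

end Stmt8Aux

/-- if `0 < α < 1/2` and `α ≤ p((−∞,n]) ≤ 1−α`, then
`‖p⋆p₁ − p⋆p₂‖₁ ≥ 2α` for the normalized restrictions `p₁, p₂`. -/
theorem stmt8 (α : ℝ) (hα₀ : 0 < α) (hα₁ : α < 1 / 2) (n : ℤ) (p : ℤ → ℝ) (hp : IsPMF p)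
    (h₁ : α ≤ headMass p n) (h₂ : headMass p n ≤ 1 - α) :
    l1dist (conv p (headPart p n)) (conv p (tailPart p n)) ≥ 2 * α := by
  obtain ⟨hp0, hps⟩ := hp
  have sp := hps.summable
  set P : ℤ → ℝ := fun k => if k ≤ n then p k else 0 with hPdef
  set Q : ℤ → ℝ := fun k => if n + 1 ≤ k then p k else 0 with hQdef
  have hPQ : ∀ k, p k = P k + Q k := by
    intro k; simp only [hPdef, hQdef]
    split_ifs <;> first | omega | simp
  have hP0 : ∀ k, 0 ≤ P k := by
    intro k; simp only [hPdef]; split_ifs <;> simp [hp0]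
  have hQ0 : ∀ k, 0 ≤ Q k := by
    intro k; simp only [hQdef]; split_ifs <;> simp [hp0]
  have sP : Summable P := sp.of_nonneg_of_le hP0 fun k => by linarith [hPQ k, hQ0 k]
  have sQ : Summable Q := sp.of_nonneg_of_le hQ0 fun k => by linarith [hPQ k, hP0 k]
  have hP : HasSum P (headMass p n) := sP.hasSum
  have hQ : HasSum Q (tailMass p n) := sQ.hasSum
  have hsum : headMass p n + tailMass p n = 1 := by
    refine HasSum.unique (hP.add hQ) ?_
    simpa only [← hPQ] using hps
  have ha : 0 < headMass p n := by linarith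
  have hb : 0 < tailMass p n := by linarith
  have hm := Stmt8Aux.main _ _ ha hb n P Q hP0 hQ0 hP hQ
    (fun k hk => by simp only [hPdef]; rw [if_neg (by omega)])
    (fun k hk => by simp only [hQdef]; rw [if_neg (by omega)])
  have hmin : α ≤ min (headMass p n) (tailMass p n) := le_min h₁ (by linarith)
  have e1 : headPart p n = fun k => P k / headMass p n := by
    funext k; simp only [headPart, hPdef]; split_ifs <;> simp
  have e2 : tailPart p n = fun k => Q k / tailMass p n := by
    funext k; simp only [tailPart, hQdef]; split_ifs <;> simp
  have e3 : l1dist (conv p (headPart p n)) (conv p (tailPart p n)) =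
      ∑' k, |conv (fun k => P k + Q k)
        (fun k => P k / headMass p n - Q k / tailMass p n) k| := by
    unfold l1dist
    refine tsum_congr fun k => ?_
    rw [e1, e2]
    simp only [← hPQ]
    congr 1
    unfold conv
    rw [← Summable.tsum_sub (Stmt8Aux.conv_pt sp (sP.div_const _) k)
      (Stmt8Aux.conv_pt sp (sQ.div_const _) k)]
    refine tsum_congr fun j => ?_
    ring
  rw [e3]
  linarith
end

section
/- Let p₁, p₂ and p be probability distributions on ℤ such that p₁ and p₂ have disjoint supports, and let x = ‖p‖_∞. Then ‖p⋆p₁ − p⋆p₂‖₁ ≥ 2(2x−1)⁺. -/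
/-- if `p₁` and `p₂` have disjoint supports and `x = ‖p‖_∞`, then
`‖p⋆p₁ − p⋆p₂‖₁ ≥ 2(2x−1)⁺`. -/
theorem stmt9 (p p₁ p₂ : ℤ → ℝ) (x : ℝ) (hp : IsPMF p) (hp₁ : IsPMF p₁) (hp₂ : IsPMF p₂)
    (hdisj : ∀ k, p₁ k = 0 ∨ p₂ k = 0) (hx : x = ⨆ i, p i) :
    l1dist (conv p p₁) (conv p p₂) ≥ 2 * max (2 * x - 1) 0 := by
  obtain ⟨hp0, hps⟩ := hp
  obtain ⟨h10, h1s⟩ := hp₁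
  obtain ⟨h20, h2s⟩ := hp₂
  have hr : ∀ k, |p₁ k - p₂ k| = p₁ k + p₂ k := by
    intro k
    rcases hdisj k with h | h
    · rw [h, zero_sub, abs_neg, abs_of_nonneg (h20 k), zero_add]
    · rw [h, sub_zero, abs_of_nonneg (h10 k), add_zero]
  let s : ℤ → ℝ := fun k => p₁ k + p₂ k
  have hs0 : ∀ k, 0 ≤ s k := fun k => add_nonneg (h10 k) (h20 k)
  have hss : HasSum s 2 := by
    have := h1s.add h2s
    norm_num at this
    exact this
  let e : ℤ × ℤ ≃ ℤ × ℤ :=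
    { toFun := fun a => (a.2, a.1 - a.2)
      invFun := fun b => (b.1 + b.2, b.1)
      left_inv := fun a => by simp
      right_inv := fun b => by simp }
  have hsumm : Summable (fun b : ℤ × ℤ => p b.1 * s b.2) :=
    hps.summable.mul_of_nonneg hss.summable hp0 hs0
  have hprod : HasSum (fun b : ℤ × ℤ => p b.1 * s b.2) (1 * 2) :=
    hps.mul hss hsumm
  have hF : HasSum (fun a : ℤ × ℤ => p a.2 * s (a.1 - a.2)) (1 * 2) :=
    (e.hasSum_iff (f := fun b : ℤ × ℤ => p b.1 * s b.2)).2 hprod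
  have hfib : ∀ k, Summable (fun j => p j * s (k - j)) := fun k => hF.summable.prod_factor k
  let G : ℤ → ℝ := fun k => ∑' j, p j * s (k - j)
  have hG : HasSum G (1 * 2) := hF.prod_fiberwise (fun k => (hfib k).hasSum)
  have hf1 : ∀ k, Summable (fun j => p j * p₁ (k - j)) := fun k =>
    Summable.of_nonneg_of_le (fun j => mul_nonneg (hp0 j) (h10 _))
      (fun j => mul_le_mul_of_nonneg_left (le_add_of_nonneg_right (h20 _)) (hp0 j)) (hfib k)
  have hf2 : ∀ k, Summable (fun j => p j * p₂ (k - j)) := fun k =>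
    Summable.of_nonneg_of_le (fun j => mul_nonneg (hp0 j) (h20 _))
      (fun j => mul_le_mul_of_nonneg_left (le_add_of_nonneg_left (h10 _)) (hp0 j)) (hfib k)
  have hc1 : ∀ k, 0 ≤ conv p p₁ k := fun k => tsum_nonneg fun j => mul_nonneg (hp0 j) (h10 _)
  have hc2 : ∀ k, 0 ≤ conv p p₂ k := fun k => tsum_nonneg fun j => mul_nonneg (hp0 j) (h20 _)
  have hGeq : ∀ k, G k = conv p p₁ k + conv p p₂ k := by
    intro k
    change ∑' j, p j * (p₁ (k - j) + p₂ (k - j)) = _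
    simp only [mul_add]
    exact (hf1 k).tsum_add (hf2 k)
  have hD : Summable (fun k => |conv p p₁ k - conv p p₂ k|) := by
    refine Summable.of_nonneg_of_le (fun k => abs_nonneg _) (fun k => ?_) hG.summable
    rw [hGeq k, abs_le]
    constructor <;> linarith [hc1 k, hc2 k]
  have hnn : 0 ≤ l1dist (conv p p₁) (conv p p₂) := tsum_nonneg fun k => abs_nonneg _
  have key : ∀ m, 2 * (2 * p m - 1) ≤ l1dist (conv p p₁) (conv p p₂) := by
    intro m
    have hshift : HasSum (fun k => s (k - m)) 2 := (Equiv.subRight m).hasSum_iff.2 hss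
    have hL : HasSum (fun k => 2 * p m * s (k - m) - G k) (2 * p m * 2 - 1 * 2) :=
      (hshift.mul_left _).sub hG
    have hle := hasSum_le (fun k => ?_) hL hD.hasSum
    · unfold l1dist
      linarith
    · have g1 := (hf1 k).le_tsum m (fun j _ => mul_nonneg (hp0 j) (h10 _))
      have g2 := (hf2 k).le_tsum m (fun j _ => mul_nonneg (hp0 j) (h20 _))
      change p m * p₁ (k - m) ≤ conv p p₁ k at g1
      change p m * p₂ (k - m) ≤ conv p p₂ k at g2
      rw [hGeq k]
      change 2 * p m * (p₁ (k - m) + p₂ (k - m)) - _ ≤ _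
      rcases hdisj (k - m) with h | h
      · rw [h] at g1 ⊢
        linarith [neg_abs_le (conv p p₁ k - conv p p₂ k)]
      · rw [h] at g2 ⊢
        linarith [le_abs_self (conv p p₁ k - conv p p₂ k)]
  have hxle : x ≤ (l1dist (conv p p₁) (conv p p₂) / 2 + 1) / 2 := by
    rw [hx]
    exact ciSup_le fun m => by linarith [key m]
  rcases max_cases (2 * x - 1) 0 with ⟨h, _⟩ | ⟨h, _⟩ <;> rw [h] <;> linarith
end

section
/- Let 0 < α < 1/2, let n ∈ ℤ, and let p be a probability distribution on ℤ with finite entropy H(p) = c and α ≤ p((−∞,n]) ≤ 1−α. Let p₁ = p|_{(−∞,n]} / p((−∞,n]) and p₂ = p|_{[n+1,∞)} / p([n+1,∞)) be the normalized restrictions of p to (−∞,n] and [n+1,∞). Then H(p⋆p) − c ≥ (α²/(2 ln 2)) · ‖p⋆p₁ − p⋆p₂‖₁². -/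
theorem HasSum.congr_fun' {ι : Type} {f g : ι → ℝ} {A : ℝ} (h : HasSum f A)
    (e : ∀ i, g i = f i) : HasSum g A := by
  have : g = f := funext e
  rw [this]; exact h

open MeasureTheory ProbabilityTheory in
theorem hoeff (m l : ℝ) (h1 : -1 ≤ m) (h2 : m ≤ 1) :
    Real.cosh l + m * Real.sinh l ≤ Real.exp (l * m + l ^ 2 / 2) := by
  let μ : Measure ℝ := ENNReal.ofReal ((1+m)/2) • Measure.dirac 1 + ENNReal.ofReal ((1-m)/2) • Measure.dirac (-1)
  have hμ : IsProbabilityMeasure μ := by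
    constructor
    simp only [μ, Measure.add_apply, Measure.smul_apply, measure_univ, smul_eq_mul, mul_one]
    rw [← ENNReal.ofReal_add (by linarith) (by linarith)]
    ring_nf; simp
  have hint : ∀ g : ℝ → ℝ, ∫ x, g x ∂μ = (1+m)/2 * g 1 + (1-m)/2 * g (-1) := by
    intro g
    rw [integral_add_measure, integral_smul_measure, integral_smul_measure, integral_dirac, integral_dirac,
      ENNReal.toReal_ofReal (by linarith), ENNReal.toReal_ofReal (by linarith)]
    · simp
    · exact (integrable_dirac (by simp)).smul_measure (by simp)
    · exact (integrable_dirac (by simp)).smul_measure (by simp)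
  have hae : ∀ᵐ x ∂μ, (id x : ℝ) ∈ Set.Icc (-1:ℝ) 1 := by
    rw [ae_add_measure_iff]
    constructor
    · apply Measure.ae_smul_measure; rw [ae_dirac_iff (by measurability)]; simp
    · apply Measure.ae_smul_measure; rw [ae_dirac_iff (by measurability)]; simp
  have h := (hasSubgaussianMGF_of_mem_Icc (X := id) aemeasurable_id hae).mgf_le l
  rw [mgf, hint, hint] at h
  simp only [id] at h
  have hm : (1+m)/2 * 1 + (1-m)/2 * (-1) = m := by ring
  rw [hm] at h
  have e : (1 - (-1:ℝ)) = 2 := by norm_num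
  rw [e] at h
  simp at h
  have e1 : Real.exp (l * (1-m)) = Real.exp l * Real.exp (-(l*m)) := by rw [← Real.exp_add]; ring_nf
  have e2 : Real.exp (l * (-1-m)) = Real.exp (-l) * Real.exp (-(l*m)) := by rw [← Real.exp_add]; ring_nf
  rw [e1, e2] at h
  rw [Real.exp_add, Real.cosh_eq, Real.sinh_eq]
  have e3 : Real.exp (l*m) * Real.exp (-(l*m)) = 1 := by rw [← Real.exp_add]; simp
  have := mul_le_mul_of_nonneg_left h (Real.exp_pos (l*m)).le
  refine le_trans (le_of_eq ?_) this
  linear_combination (-((1+m)/2 * Real.exp l + (1-m)/2 * Real.exp (-l))) * e3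

theorem prodSum {g h : ℤ → ℝ} (hg : Summable g) (hh : Summable h) :
    HasSum (fun z : ℤ × ℤ => g z.1 * h (z.2 - z.1)) ((∑' j, g j) * ∑' k, h k) := by
  have h0 : Summable (fun z : ℤ × ℤ => g z.1 * h z.2) := by
    exact summable_mul_of_summable_norm hg.norm hh.norm
  have h1 := hg.hasSum.mul hh.hasSum h0
  exact (Equiv.hasSum_iff (Equiv.prodShear (Equiv.refl ℤ) (fun j => Equiv.subRight j))
    (f := fun z : ℤ × ℤ => g z.1 * h z.2)).2 h1

theorem fib {F : ℤ × ℤ → ℝ} {A : ℝ} (hF : HasSum F A) :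
    HasSum (fun k => ∑' j, F (j, k)) A := by
  have h1 : HasSum (fun z : ℤ × ℤ => F (z.2, z.1)) A :=
    (Equiv.hasSum_iff (Equiv.prodComm ℤ ℤ) (f := F)).2 hF
  exact h1.prod_fiberwise (fun k => (h1.summable.prod_factor k).hasSum)

theorem conv_comm' (p h : ℤ → ℝ) (k : ℤ) : conv p h k = ∑' j, h j * p (k - j) := by
  unfold conv
  rw [← Equiv.tsum_eq (Equiv.subLeft k)]
  apply tsum_congr; intro j
  simp [mul_comm]

theorem tangent {x y f : ℝ} (hx : 0 < x) (hy : 0 < y) :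
    x * f + x - y * Real.exp f ≤ x * (Real.log x - Real.log y) := by
  have h := Real.add_one_le_exp (f - Real.log x + Real.log y)
  have e : Real.exp (f - Real.log x + Real.log y) = Real.exp f / x * y := by
    rw [Real.exp_add, Real.exp_sub, Real.exp_log hx, Real.exp_log hy]
  rw [e] at h
  have := mul_le_mul_of_nonneg_left h hx.le
  have e2 : x * (Real.exp f / x * y) = y * Real.exp f := by field_simp
  rw [e2] at this
  linarith

theorem mainNat (n : ℤ) (p : ℤ → ℝ) (a : ℝ) (S : ℝ) (h t : ℤ → ℝ)
    (hp0 : ∀ k, 0 ≤ p k) (hp1 : HasSum p 1)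
    (hS : HasSum (fun k => -(p k * Real.log (p k))) S)
    (ha0 : 0 < a) (ha1 : a < 1)
    (hh : HasSum h 1) (ht : HasSum t 1)
    (hhe : ∀ k, h k = if k ≤ n then p k / a else 0)
    (hte : ∀ k, t k = if k ≤ n then 0 else p k / (1 - a)) :
    a * (1 - a) / 2 * (l1dist (conv p h) (conv p t)) ^ 2 ≤
      (∑' k, -(conv p p k * Real.log (conv p p k))) - S := by
  set q := conv p p with hq
  have hqe : ∀ k, q k = ∑' j, p j * p (k - j) := fun k => rfl
  have hps := hp1.summable
  have hW : HasSum (fun z : ℤ × ℤ => p z.1 * p (z.2 - z.1)) 1 := by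
    simpa [hp1.tsum_eq] using prodSum hps hps
  have hWs : ∀ k, Summable (fun j => p j * p (k - j)) := fun k => by
    have := hW.summable.prod_symm.prod_factor k
    exact this
  have hq1 : HasSum q 1 := fib hW
  have hq0 : ∀ k, 0 ≤ q k := fun k => tsum_nonneg fun j => mul_nonneg (hp0 _) (hp0 _)
  have hqle1 : ∀ k, q k ≤ 1 := fun k => le_hasSum hq1 k (fun i _ => hq0 i)
  have hple1 : ∀ k, p k ≤ 1 := fun k => le_hasSum hp1 k (fun i _ => hp0 i)
  have hwle : ∀ j k, p j * p (k - j) ≤ q k := fun j k =>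
    (hWs k).le_tsum j (fun i _ => mul_nonneg (hp0 _) (hp0 _))
  -- summability of the two pieces
  have hA1 : HasSum (fun z : ℤ × ℤ => -(p z.1 * Real.log (p z.1)) * p (z.2 - z.1)) S := by
    simpa [hp1.tsum_eq, hS.tsum_eq] using prodSum hS.summable hps
  have hA2 : HasSum (fun z : ℤ × ℤ => p z.1 * -(p (z.2 - z.1) * Real.log (p (z.2 - z.1)))) S := by
    simpa [hp1.tsum_eq, hS.tsum_eq] using prodSum hps hS.summable
  have hB : Summable (fun z : ℤ × ℤ => -(p z.1 * p (z.2 - z.1) * Real.log (q z.2))) := by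
    refine Summable.of_nonneg_of_le (fun z => ?_) (fun z => ?_) (hA1.summable.add hA2.summable)
    · have := Real.log_nonpos (hq0 z.2) (hqle1 z.2)
      have := mul_nonneg (hp0 z.1) (hp0 (z.2 - z.1))
      nlinarith
    · obtain ⟨j, k⟩ := z
      dsimp only
      rcases (hp0 j).eq_or_lt with h0 | h0
      · simp [← h0]
      rcases (hp0 (k - j)).eq_or_lt with h0' | h0'
      · simp [← h0']
      have h1 := Real.log_le_log (mul_pos h0 h0') (hwle j k)
      rw [Real.log_mul h0.ne' h0'.ne'] at h1
      have := mul_le_mul_of_nonneg_left h1 (mul_pos h0 h0').le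
      linarith
  have hBsum : (∑' z : ℤ × ℤ, -(p z.1 * p (z.2 - z.1) * Real.log (q z.2))) =
      ∑' k, -(q k * Real.log (q k)) := by
    rw [← (fib hB.hasSum).tsum_eq]
    apply tsum_congr; intro k
    dsimp only
    rw [tsum_neg, tsum_mul_right, ← hqe]
  rw [← hBsum]
  have hD : HasSum (fun z : ℤ × ℤ => p z.1 * (p (z.2 - z.1) *
      (Real.log (p (z.2 - z.1)) - Real.log (q z.2))))
      ((∑' z : ℤ × ℤ, -(p z.1 * p (z.2 - z.1) * Real.log (q z.2))) - S) := by
    refine (hB.hasSum.sub hA2).congr_fun' ?_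
    intro z; ring
  set δ := l1dist (conv p h) (conv p t) with hδ
  -- sign function
  let s : ℤ → ℝ := fun k => if 0 ≤ conv p h k - conv p t k then 1 else -1
  have hs : ∀ k, s k = 1 ∨ s k = -1 := fun k => by
    by_cases hk : 0 ≤ conv p h k - conv p t k
    · left; simp only [s, if_pos hk]
    · right; simp only [s, if_neg hk]
  have hsabs : ∀ k, |s k| = 1 := fun k => by rcases hs k with e | e <;> simp [e]
  have hbd : ∀ {ι : Type} (F : ι → ℝ) (u : ι → ℝ) (C : ℝ), Summable F → (∀ i, |u i| ≤ C) →
      Summable (fun i => F i * u i) := by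
    intro ι F u C hF hu
    refine Summable.of_norm_bounded (hF.norm.mul_right C) (fun i => ?_)
    rw [norm_mul]
    exact mul_le_mul_of_nonneg_left (hu i) (norm_nonneg _)
  have hqs : Summable (fun k => q k * s k) := hbd _ _ 1 hq1.summable (fun k => (hsabs k).le)
  set m := ∑' k, q k * s k with hm
  have hm1 : m ≤ 1 := by
    rw [← hq1.tsum_eq]
    refine hqs.tsum_le_tsum (fun k => ?_) hq1.summable
    rcases hs k with e | e <;> rw [e] <;> linarith [hq0 k]
  have hm2 : -1 ≤ m := by
    rw [← hq1.tsum_eq, ← tsum_neg]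
    refine Summable.tsum_le_tsum (fun k => ?_) hq1.summable.neg hqs
    rcases hs k with e | e <;> rw [e] <;> linarith [hq0 k]
  -- exponential moment
  have hexp : ∀ l : ℝ, HasSum (fun k => q k * Real.exp (l * s k - l * m - l ^ 2 / 2))
      ((Real.cosh l + m * Real.sinh l) * Real.exp (-(l * m + l ^ 2 / 2))) := by
    intro l
    have h1 := ((hq1.mul_right (Real.cosh l)).add (hqs.hasSum.mul_right (Real.sinh l))).mul_right
      (Real.exp (-(l * m + l ^ 2 / 2)))
    rw [one_mul] at h1
    refine h1.congr_fun' ?_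
    intro k
    have e1 : l * s k - l * m - l ^ 2 / 2 = l * s k + (-(l * m + l ^ 2 / 2)) := by ring
    rw [e1, Real.exp_add]
    have e2 : Real.exp (l * s k) = Real.cosh l + s k * Real.sinh l := by
      rcases hs k with e | e
      · rw [e, mul_one, one_mul, Real.cosh_add_sinh]
      · rw [e, mul_neg, mul_one, ← Real.cosh_sub_sinh]; ring
    rw [e2]; ring
  have hexple : ∀ l : ℝ, (Real.cosh l + m * Real.sinh l) * Real.exp (-(l * m + l ^ 2 / 2)) ≤ 1 := by
    intro l
    have h1 := mul_le_mul_of_nonneg_right (hoeff m l hm2 hm1) (Real.exp_pos (-(l * m + l ^ 2 / 2))).le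
    rwa [← Real.exp_add, add_neg_cancel, Real.exp_zero] at h1
  have hb0 : 0 < 1 - a := by linarith
  let L : ℤ → ℝ := fun j => if j ≤ n then (1 - a) * δ else -(a * δ)
  have hpL : ∀ j, p j * L j = (h j - t j) * (δ * (a * (1 - a))) := by
    intro j
    rw [hhe, hte]; simp only [L]
    split_ifs
    · field_simp; ring
    · field_simp; ring
  have hpLL : ∀ j, p j * L j ^ 2 = ((1 - a) * h j + a * t j) * (δ ^ 2 * (a * (1 - a))) := by
    intro j
    rw [hhe, hte]; simp only [L]
    split_ifs
    · field_simp; ring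
    · field_simp; ring
  have hLs : HasSum (fun j => p j * L j) 0 := by
    have := (hh.sub ht).mul_right (δ * (a * (1 - a)))
    rw [sub_self, zero_mul] at this
    exact this.congr_fun' hpL
  have hLLs : HasSum (fun j => p j * L j ^ 2) (δ ^ 2 * (a * (1 - a))) := by
    have := ((hh.mul_left (1 - a)).add (ht.mul_left a)).mul_right (δ ^ 2 * (a * (1 - a)))
    have e : ((1 - a) * 1 + a * 1) * (δ ^ 2 * (a * (1 - a))) = δ ^ 2 * (a * (1 - a)) := by ring
    rw [e] at this
    exact this.congr_fun' hpLL
  -- the linear term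
  have hhp := prodSum hh.summable hps
  have htp := prodSum ht.summable hps
  have hlin : HasSum (fun z : ℤ × ℤ => (h z.1 - t z.1) * p (z.2 - z.1) * s z.2) δ := by
    have hsm : Summable (fun z : ℤ × ℤ => (h z.1 - t z.1) * p (z.2 - z.1) * s z.2) := by
      refine hbd _ (fun z : ℤ × ℤ => s z.2) 1 ?_ (fun z => (hsabs _).le)
      exact (prodSum (hh.summable.sub ht.summable) hps).summable
    have h1 := fib hsm.hasSum
    have e : δ = ∑' z : ℤ × ℤ, (h z.1 - t z.1) * p (z.2 - z.1) * s z.2 := by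
      rw [← h1.tsum_eq, hδ, l1dist]
      apply tsum_congr; intro k
      dsimp only
      rw [tsum_mul_right]
      have hk1 : Summable (fun j => h j * p (k - j)) := hhp.summable.prod_symm.prod_factor k
      have hk2 : Summable (fun j => t j * p (k - j)) := htp.summable.prod_symm.prod_factor k
      have e1 : ∑' j, (h j - t j) * p (k - j) = conv p h k - conv p t k := by
        rw [conv_comm', conv_comm', ← hk1.tsum_sub hk2]
        apply tsum_congr; intro j; ring
      rw [e1]
      by_cases hk : 0 ≤ conv p h k - conv p t k
      · simp only [s, if_pos hk, abs_of_nonneg hk, mul_one]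
      · simp only [s, if_neg hk, abs_of_neg (not_le.1 hk)]; ring
    rw [e]; exact hsm.hasSum
  have hLp : HasSum (fun z : ℤ × ℤ => p z.1 * L z.1 * p (z.2 - z.1)) 0 := by
    simpa [hLs.tsum_eq] using prodSum hLs.summable hps
  have hLLp : HasSum (fun z : ℤ × ℤ => p z.1 * L z.1 ^ 2 * p (z.2 - z.1)) (δ ^ 2 * (a * (1 - a))) := by
    simpa [hLLs.tsum_eq, hp1.tsum_eq] using prodSum hLLs.summable hps
  have hG1 : HasSum (fun z : ℤ × ℤ => p z.1 * p (z.2 - z.1) *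
      (L z.1 * s z.2 - L z.1 * m - L z.1 ^ 2 / 2)) (a * (1 - a) / 2 * δ ^ 2) := by
    have h1 := ((hlin.mul_right (δ * (a * (1 - a)))).sub (hLp.mul_right m)).sub (hLLp.div_const 2)
    have e : δ * (δ * (a * (1 - a))) - 0 * m - δ ^ 2 * (a * (1 - a)) / 2 = a * (1 - a) / 2 * δ ^ 2 := by
      ring
    rw [e] at h1
    refine h1.congr_fun' ?_
    intro z
    have := hpL z.1
    linear_combination (p (z.2 - z.1) * s z.2) * this
  have hfib : ∀ j, HasSum (fun k => p j * (q k * Real.exp (L j * s k - L j * m - L j ^ 2 / 2)))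
      (p j * ((Real.cosh (L j) + m * Real.sinh (L j)) * Real.exp (-(L j * m + L j ^ 2 / 2)))) :=
    fun j => (hexp (L j)).mul_left _
  have hE0 : ∀ z : ℤ × ℤ, 0 ≤ p z.1 * (q z.2 * Real.exp (L z.1 * s z.2 - L z.1 * m - L z.1 ^ 2 / 2)) :=
    fun z => mul_nonneg (hp0 _) (mul_nonneg (hq0 _) (Real.exp_pos _).le)
  have hrle : ∀ j, p j * ((Real.cosh (L j) + m * Real.sinh (L j)) *
      Real.exp (-(L j * m + L j ^ 2 / 2))) ≤ p j := fun j =>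
    mul_le_of_le_one_right (hp0 j) (hexple _)
  have hr0 : ∀ j, 0 ≤ p j * ((Real.cosh (L j) + m * Real.sinh (L j)) *
      Real.exp (-(L j * m + L j ^ 2 / 2))) := fun j => by
    rw [← (hfib j).tsum_eq]; exact tsum_nonneg (fun k => hE0 (j, k))
  have hrs := Summable.of_nonneg_of_le hr0 hrle hps
  have hEs : Summable (fun z : ℤ × ℤ =>
      p z.1 * (q z.2 * Real.exp (L z.1 * s z.2 - L z.1 * m - L z.1 ^ 2 / 2))) := by
    rw [summable_prod_of_nonneg hE0]
    refine ⟨fun j => (hfib j).summable, ?_⟩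
    refine hrs.congr ?_
    intro j; exact (hfib j).tsum_eq.symm
  have hEle : (∑' z : ℤ × ℤ,
      p z.1 * (q z.2 * Real.exp (L z.1 * s z.2 - L z.1 * m - L z.1 ^ 2 / 2))) ≤ 1 := by
    rw [← (hEs.hasSum.prod_fiberwise hfib).tsum_eq, ← hp1.tsum_eq]
    exact hrs.tsum_le_tsum hrle hps
  have hfin := hasSum_le (fun z : ℤ × ℤ => ?_) ((hG1.add hW).sub hEs.hasSum) hD
  · linarith
  · obtain ⟨j, k⟩ := z
    dsimp only
    set f := L j * s k - L j * m - L j ^ 2 / 2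
    rcases (hp0 j).eq_or_lt with h0 | h0
    · simp [← h0]
    rcases (hp0 (k - j)).eq_or_lt with h0' | h0'
    · have := hE0 (j, k)
      dsimp only at this
      rw [← h0']; simp; exact this
    have hqk : 0 < q k := lt_of_lt_of_le (mul_pos h0 h0') (hwle j k)
    have := mul_le_mul_of_nonneg_left (tangent (f := f) h0' hqk) h0.le
    refine le_trans (le_of_eq ?_) this
    ring

/-- if `0 < α < 1/2`, `H(p) = c` is finite and `α ≤ p((−∞,n]) ≤ 1−α`, then
`H(p⋆p) − c ≥ (α²/(2 ln 2))·‖p⋆p₁ − p⋆p₂‖₁²` for the normalized restrictions `p₁, p₂`. -/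
theorem stmt10 (α : ℝ) (hα₀ : 0 < α) (hα₁ : α < 1 / 2) (n : ℤ) (p : ℤ → ℝ) (c : ℝ)
    (hp : IsPMF p) (hc : HasSum (fun k => -(p k * Real.logb 2 (p k))) c)
    (h₁ : α ≤ headMass p n) (h₂ : headMass p n ≤ 1 - α) :
    entH (conv p p) - c ≥
      α ^ 2 / (2 * Real.log 2) *
        (l1dist (conv p (headPart p n)) (conv p (tailPart p n))) ^ 2 := by
  obtain ⟨hp0, hp1⟩ := hp
  set a := headMass p n with ha
  have hps := hp1.summable
  have hh1 : Summable (fun k => if k ≤ n then p k else 0) :=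
    Summable.of_nonneg_of_le (fun k => by split_ifs <;> simp [hp0]) (fun k => by
      split_ifs <;> simp [hp0]) hps
  have hH : HasSum (fun k => if k ≤ n then p k else 0) a := hh1.hasSum
  have hT : HasSum (fun k => if n + 1 ≤ k then p k else 0) (1 - a) := by
    refine (hp1.sub hH).congr_fun' ?_
    intro k
    by_cases hk : k ≤ n
    · simp [hk, show ¬ (n + 1 ≤ k) by omega]
    · simp [hk, show n + 1 ≤ k by omega]
  have htm : tailMass p n = 1 - a := hT.tsum_eq
  have ha0 : 0 < a := by linarith
  have hb0 : 0 < 1 - a := by linarith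
  have hl2 : 0 < Real.log 2 := Real.log_pos (by norm_num)
  have hS : HasSum (fun k => -(p k * Real.log (p k))) (c * Real.log 2) := by
    refine (hc.mul_right (Real.log 2)).congr_fun' ?_
    intro k
    rw [Real.logb]; field_simp
  have key := mainNat n p a (c * Real.log 2) (headPart p n) (tailPart p n) hp0 hp1 hS ha0 (by linarith)
    (by
      have := hH.div_const a
      rw [div_self ha0.ne'] at this
      refine this.congr_fun' ?_
      intro k; simp only [headPart, ← ha]; split_ifs <;> simp)
    (by
      have := hT.div_const (1 - a)
      rw [div_self hb0.ne'] at this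
      refine this.congr_fun' ?_
      intro k; simp only [tailPart, htm]; split_ifs <;> simp)
    (fun k => rfl)
    (fun k => by
      simp only [tailPart, htm]
      by_cases hk : k ≤ n
      · simp [hk, show ¬ (n + 1 ≤ k) by omega]
      · simp [hk, show n + 1 ≤ k by omega])
  have hent : entH (conv p p) = (∑' k, -(conv p p k * Real.log (conv p p k))) / Real.log 2 := by
    rw [entH, ← tsum_div_const]
    apply tsum_congr; intro k
    rw [Real.logb]; ring
  rw [hent]
  set δ := l1dist (conv p (headPart p n)) (conv p (tailPart p n))
  have hab : α ^ 2 ≤ a * (1 - a) := by nlinarith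
  have h3 : α ^ 2 / 2 * δ ^ 2 ≤ a * (1 - a) / 2 * δ ^ 2 := by
    have := sq_nonneg δ
    nlinarith
  have h4 := div_le_div_of_nonneg_right (h3.trans key) hl2.le
  have e1 : α ^ 2 / (2 * Real.log 2) * δ ^ 2 = α ^ 2 / 2 * δ ^ 2 / Real.log 2 := by field_simp
  rw [e1, ge_iff_le]
  refine h4.trans (le_of_eq ?_)
  field_simp
end
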